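/- Under the standing assumptions, and with E_0 a constant as specified, there exists L_1 > 0 such that for every natural number L > L_1 and every η > 0 there exists ε > 0 with limsup_{n→∞} #(B_S(n) \ W_{L,ε}(n)) / #B_S(n) ≤ η. -/

import Mathlib

namespace AcylCount

/-! ### Geodesic segments and Gromov hyperbolicity -/

/-- A finite geodesic segment in a metric space, parametrized by arclength on `[0, len]`,
oriented from `initial := toFun 0` to `terminal := toFun len`. -/
structure GeodesicSegment (X : Type*) [MetricSpace X] where
  len : ℝ
  len_nonneg : 0 ≤ len
  toFun : ℝ → X
  isom : ∀ s ∈ Set.Icc (0:ℝ) len, ∀ t ∈ Set.Icc (0:ℝ) len,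
    dist (toFun s) (toFun t) = |s - t|

namespace GeodesicSegment

variable {X : Type*} [MetricSpace X]

/-- The initial point of a geodesic segment. -/
def initial (γ : GeodesicSegment X) : X := γ.toFun 0

/-- The terminal point of a geodesic segment. -/
def terminal (γ : GeodesicSegment X) : X := γ.toFun γ.len

/-- The image (underlying set) of a geodesic segment. -/
def seg (γ : GeodesicSegment X) : Set X := γ.toFun '' Set.Icc 0 γ.len

/-- The translate of a geodesic segment by an isometry. -/
def translate (γ : GeodesicSegment X) (f : X → X) (hf : Isometry f) :
    GeodesicSegment X where
  len := γ.len
  len_nonneg := γ.len_nonneg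
  toFun := f ∘ γ.toFun
  isom := fun s hs t ht => by
    simp only [Function.comp_apply, hf.dist_eq]
    exact γ.isom s hs t ht

/-- The degenerate geodesic segment consisting of a single point. -/
def point (p : X) : GeodesicSegment X where
  len := 0
  len_nonneg := le_refl 0
  toFun := fun _ => p
  isom := fun s hs t ht => by
    have hs0 : s = 0 := le_antisymm hs.2 hs.1
    have ht0 : t = 0 := le_antisymm ht.2 ht.1
    simp [hs0, ht0]

/-- `η` is a subsegment of `γ`. -/
def IsSubsegment (η γ : GeodesicSegment X) : Prop :=
  ∃ a b : ℝ, 0 ≤ a ∧ a ≤ b ∧ b ≤ γ.len ∧ η.len = b - a ∧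
    ∀ t ∈ Set.Icc (0:ℝ) η.len, η.toFun t = γ.toFun (a + t)

/-- `p` occurs (weakly) before `q` along the oriented geodesic segment `γ`. -/
def Before (γ : GeodesicSegment X) (p q : X) : Prop :=
  ∃ s t : ℝ, s ∈ Set.Icc (0:ℝ) γ.len ∧ t ∈ Set.Icc (0:ℝ) γ.len ∧ s ≤ t ∧
    γ.toFun s = p ∧ γ.toFun t = q

end GeodesicSegment

/-- A geodesic metric space: every two points are joined by a geodesic segment. -/
def IsGeodesicSpace (X : Type*) [MetricSpace X] : Prop :=
  ∀ x y : X, ∃ γ : GeodesicSegment X, γ.initial = x ∧ γ.terminal = y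

/-- δ-hyperbolicity via slim triangles: each side of a geodesic triangle lies in the
closed δ-neighborhood of the union of the other two sides. -/
def IsDeltaHyperbolic (X : Type*) [MetricSpace X] (δ : ℝ) : Prop :=
  ∀ γ₁ γ₂ γ₃ : GeodesicSegment X,
    γ₁.initial = γ₃.initial → γ₁.terminal = γ₂.initial → γ₂.terminal = γ₃.terminal →
    γ₃.seg ⊆ Metric.cthickening δ (γ₁.seg ∪ γ₂.seg)

variable {X : Type*} [MetricSpace X]

/-- The closest point projection of `x` to (the image of) the geodesic `γ`. -/
def proj (γ : GeodesicSegment X) (x : X) : Set X :=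
  {p | p ∈ γ.seg ∧ dist x p = Metric.infDist x γ.seg}

/-- The closest point projection of a set `A` to the geodesic `γ`. -/
def projSet (γ : GeodesicSegment X) (A : Set X) : Set X :=
  ⋃ a ∈ A, proj γ a

/-- The ordered pair of oriented geodesic segments `(γ, η)` is `K`-aligned. -/
def AlignedPair (K : ℝ) (γ η : GeodesicSegment X) : Prop :=
  Metric.diam (projSet γ η.seg ∪ {γ.terminal}) < K ∧
  Metric.diam (projSet η γ.seg ∪ {η.initial}) < K

/-- A sequence of oriented geodesic segments is `K`-aligned if each consecutive
pair is `K`-aligned. -/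
def AlignedSeq (K : ℝ) (l : List (GeodesicSegment X)) : Prop :=
  l.Chain' (AlignedPair K)

/-- The Gromov product `(y, z)_x`. -/
noncomputable def gromovProd (x y z : X) : ℝ := (dist y x + dist x z - dist y z) / 2

/-! ### Word metric -/

variable {G : Type*} [Group G]

/-- The word length of `g` with respect to the (symmetrized) generating set `S`. -/
noncomputable def wordLength (S : Finset G) (g : G) : ℕ :=
  sInf {n | ∃ l : List G, l.length = n ∧ (∀ x ∈ l, x ∈ S ∨ x⁻¹ ∈ S) ∧ l.prod = g}

/-- The word metric on `G` with respect to `S`. -/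
noncomputable def wordDist (S : Finset G) (g h : G) : ℕ := wordLength S (g⁻¹ * h)

/-- The ball of radius `r` in the word metric, centered at the identity. -/
def ball (S : Finset G) (r : ℝ) : Set G := {g | (wordLength S g : ℝ) ≤ r}

/-- `G` has no cyclic subgroup of finite index. -/
def NonVirtuallyCyclic (G : Type*) [Group G] : Prop :=
  ¬ ∃ H : Subgroup G, H.FiniteIndex ∧ IsCyclic H

/-! ### Isometric actions, loxodromics, WPD -/

/-- `g` is a loxodromic isometry for the action `ρ` with basepoint `x0`: the asymptotic
translation length `τ_X(g) = lim dist x0 (g^n x0) / n` exists and is positive. -/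
def IsLoxodromic (ρ : G → X → X) (x0 : X) (g : G) : Prop :=
  ∃ τ : ℝ, 0 < τ ∧
    Filter.Tendsto (fun n : ℕ => dist x0 (ρ (g ^ n) x0) / n) Filter.atTop (nhds τ)

/-- The WPD (weak proper discontinuity) property of `g` for the action `ρ` with
basepoint `x0`. -/
def HasWPD (ρ : G → X → X) (x0 : X) (g : G) : Prop :=
  ∀ K : ℝ, 0 < K → ∃ N M : ℕ,
    {h : G | dist x0 (ρ h x0) < K ∧ dist (ρ (g ^ N) x0) (ρ h (ρ (g ^ N) x0)) < K}.Finite ∧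
    {h : G | dist x0 (ρ h x0) < K ∧ dist (ρ (g ^ N) x0) (ρ h (ρ (g ^ N) x0)) < K}.ncard < M

/-- The list of translated geodesics `h 1 • Υ, …, h m • Υ`. -/
def transList (ρ : G → X → X) (hisom : ∀ g : G, Isometry (ρ g))
    (Υ : GeodesicSegment X) (h : ℕ → G) (m : ℕ) : List (GeodesicSegment X) :=
  (List.range m).map fun i => Υ.translate (ρ (h (i + 1))) (hisom _)

/-- The specification of the constant `E₀` from Fact 2.7 (Bestvina–Fujiwara):
(i) Gromov product bounds, (ii) the WPD-type conclusion for large projections. -/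
def E0Spec (S : Finset G) (ρ : G → X → X) (x0 : X) (φ : G) (E0 : ℝ) : Prop :=
  0 < E0 ∧
  (∀ g : G, ∃ s t : G, (s ∈ S ∨ s = 1) ∧ (t ∈ S ∨ t = 1) ∧
    (∀ i : ℤ, 0 < i → gromovProd x0 (ρ (φ ^ i) x0) (ρ (s * g) x0) ≤ E0) ∧
    (∀ j : ℤ, j < 0 → gromovProd x0 (ρ (φ ^ j) x0) (ρ (t * g) x0) ≤ E0)) ∧
  (∀ n : ℕ, 0 < n → ∀ g : G, ∀ γ : GeodesicSegment X,
    γ.initial = x0 → γ.terminal = ρ (φ ^ n) x0 →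
    ∀ p ∈ proj γ (ρ g x0), ∀ q ∈ proj γ (ρ (g * φ ^ n) x0),
      γ.Before p q → E0 < dist p q →
      ∃ i j : ℕ, i ≤ n ∧ j ≤ n ∧ (wordDist S (φ ^ i) (g * φ ^ j) : ℝ) < E0)

/-- The set `V_{L,ε}(n)`. Here `Υ` is the chosen geodesic `Υ_L = [x₀, φ^L x₀]`. -/
def Vset (S : Finset G) (ρ : G → X → X) (hisom : ∀ g : G, Isometry (ρ g)) (x0 : X)
    (δ E0 : ℝ) (Υ : GeodesicSegment X) (ε : ℝ) (n : ℕ) : Set G :=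
  {g | g ∈ ball S (n:ℝ) ∧ ∃ h : ℕ → G,
    AlignedSeq (6 * E0 + 300 * δ)
      ([GeodesicSegment.point x0] ++ transList ρ hisom Υ h ⌈ε * (n:ℝ)⌉₊ ++
        [GeodesicSegment.point (ρ g x0)])}

/-- The set `W_{L,ε}(n)`. Here `Υ` is the chosen geodesic `Υ_L = [x₀, φ^L x₀]`. -/
def Wset (S : Finset G) (ρ : G → X → X) (hisom : ∀ g : G, Isometry (ρ g)) (x0 : X)
    (δ E0 : ℝ) (Υ : GeodesicSegment X) (ε : ℝ) (n : ℕ) : Set G :=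
  {g | g ∈ ball S (n:ℝ) ∧ ∃ h : ℕ → G,
    AlignedSeq (6 * E0 + 360 * δ)
      ([GeodesicSegment.point x0] ++ transList ρ hisom Υ h ⌈ε * (n:ℝ)⌉₊ ++
        [GeodesicSegment.point (ρ g x0)]) ∧
    AlignedPair (6 * E0 + 360 * δ) (GeodesicSegment.point (ρ g⁻¹ x0))
      (Υ.translate (ρ (h 1)) (hisom _)) ∧
    AlignedPair (6 * E0 + 360 * δ) (Υ.translate (ρ (h ⌈ε * (n:ℝ)⌉₊)) (hisom _))
      (GeodesicSegment.point (ρ (g ^ 2) x0))}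

/-- The set `BAD_{L,ε}(n)`. -/
def BADset (S : Finset G) (ρ : G → X → X) (hisom : ∀ g : G, Isometry (ρ g)) (x0 : X)
    (δ E0 : ℝ) (Υ : GeodesicSegment X) (ε : ℝ) (n : ℕ) : Set G :=
  ball S (n:ℝ) \ (ball S ((⌊(0.9:ℝ) * (n:ℝ)⌋₊ : ℕ) : ℝ) ∪ Vset S ρ hisom x0 δ E0 Υ ε n)

/-! ### Paths in the word metric -/

/-- `P` is a `d_S`-path connecting `a` to `b`. -/
noncomputable def IsPathFrom (S : Finset G) (P : List G) (a b : G) : Prop :=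
  P ≠ [] ∧ P.Chain' (fun u v => wordDist S u v = 1) ∧ P.head? = some a ∧ P.getLast? = some b

/-- The distance `d_S(P, g)` from a path `P` to a group element `g`. -/
noncomputable def pathDist (S : Finset G) (P : List G) (g : G) : ℕ :=
  sInf {d | ∃ v ∈ P, d = wordDist S v g}

/-! ### Left-invariant hyperbolic pseudo-metrics -/

/-- `D` is a left-invariant pseudo-metric on `G` satisfying Gromov's four-point condition. -/
structure InvHyp (D : G → G → ℝ) (d : ℝ) : Prop where
  d_nonneg : 0 ≤ d
  self : ∀ x, D x x = 0
  symm : ∀ x y, D x y = D y x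
  tri : ∀ x y z, D x z ≤ D x y + D y z
  inv : ∀ k x y, D (k * x) (k * y) = D x y
  four : ∀ x y z w, D x y + D z w ≤ max (D x z + D y w) (D x w + D y z) + 2 * d

/-- The Gromov product `(x, y)_o` of a pseudo-metric `D`. -/
noncomputable def gp (D : G → G → ℝ) (o x y : G) : ℝ := (D o x + D o y - D x y) / 2

/-- The pair `h, h * f` lies coarsely, and in this order, between `x` and `y`. -/
def Marker (D : G → G → ℝ) (f : G) (c : ℝ) (x y h : G) : Prop :=
  gp D h x (h * f) ≤ c ∧ gp D (h * f) h y ≤ c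

theorem Marker.mono {D : G → G → ℝ} {f : G} {c c' : ℝ} {x y h : G} (hm : Marker D f c x y h)
    (hc : c ≤ c') : Marker D f c' x y h :=
  ⟨hm.1.trans hc, hm.2.trans hc⟩

namespace InvHyp

variable {D : G → G → ℝ} {d : ℝ} (H : InvHyp D d)
include H

theorem nonneg (x y : G) : 0 ≤ D x y := by
  have := H.tri x y x
  rw [H.self, H.symm y x] at this
  linarith

theorem gp_symm (o x y : G) : gp D o x y = gp D o y x := by
  unfold gp; rw [H.symm x y]; ring

theorem gp_nonneg (o x y : G) : 0 ≤ gp D o x y := by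
  unfold gp
  have := H.tri x o y
  rw [H.symm x o] at this
  linarith

theorem gp_inv (k o x y : G) : gp D (k * o) (k * x) (k * y) = gp D o x y := by
  unfold gp; simp only [H.inv]

theorem gp_le_dist (o x y : G) : gp D o x y ≤ D o x := by
  unfold gp
  have := H.tri o x y
  linarith

theorem gp_add (o x y : G) : gp D o x y + gp D x o y = D o x := by
  unfold gp; rw [H.symm x o]; ring

theorem gp_sub_le (o x y z : G) : gp D o x z - gp D o y z ≤ D x y := by
  unfold gp
  have h1 := H.tri o y x
  have h2 := H.tri y x z
  rw [H.symm y x] at h1 h2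
  linarith

theorem gp_sub_le' (o o' x y : G) : gp D o x y - gp D o' x y ≤ D o o' := by
  unfold gp
  have h1 := H.tri o o' x
  have h2 := H.tri o o' y
  linarith

theorem min_gp_le (o x y z : G) : min (gp D o x y) (gp D o y z) ≤ gp D o x z + d := by
  have h := H.four o y x z
  rw [min_le_iff]
  unfold gp
  rcases le_max_iff.1 (sub_le_iff_le_add.2 h) with h | h
  · right; linarith
  · left; linarith [H.symm y x]

theorem dist_le_of_gp_le {x y u v : G} {c₁ c₂ : ℝ} (hu : gp D u x y ≤ c₁) (hv : gp D v x y ≤ c₂) :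
    D u v ≤ |D x u - D x v| + 2 * max c₁ c₂ + 2 * d := by
  have h := H.four u v x y
  unfold gp at hu hv
  rw [H.symm u x] at hu h
  rw [H.symm v x] at hv h
  have h1 := le_max_left c₁ c₂
  have h2 := le_max_right c₁ c₂
  have h3 := le_abs_self (D x u - D x v)
  have h4 := neg_abs_le (D x u - D x v)
  rcases le_max_iff.1 (sub_le_iff_le_add.2 h) with h | h <;> linarith

/-- Moving the far endpoint of a marker. -/
theorem gp_right_or (b a y y' : G) {c : ℝ} (h : gp D b a y ≤ c) :
    gp D b a y' ≤ c + d ∨ gp D b y y' ≤ c + d := by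
  have := H.min_gp_le b a y' y
  rw [H.gp_symm b y' y, min_le_iff] at this
  rcases this with h' | h'
  · left; linarith
  · right; linarith

theorem gp_ge_sub (x y b z : G) : gp D x z y - D x b ≤ gp D b y z := by
  unfold gp
  have h1 := H.tri x b y
  have h2 := H.tri x b z
  rw [H.symm y z]
  linarith

end InvHyp

namespace Marker

variable {D : G → G → ℝ} {d : ℝ} {f : G} {c : ℝ} {x y h : G}

theorem inv_iff (H : InvHyp D d) (k : G) :
    Marker D f c (k * x) (k * y) (k * h) ↔ Marker D f c x y h := by
  unfold Marker
  rw [mul_assoc, H.gp_inv, H.gp_inv]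

theorem dist_eq (H : InvHyp D d) (f h : G) : D h (h * f) = D 1 f := by
  have := H.inv h 1 f
  rwa [mul_one] at this

theorem gp_left_le (H : InvHyp D d) (hf : 2 * c + d < D 1 f) (hm : Marker D f c x y h) :
    gp D h x y ≤ c + d := by
  have h1 := H.min_gp_le h x y (h * f)
  have h2 := H.gp_add h (h * f) y
  rw [dist_eq H, H.gp_symm h (h * f) y] at h2
  rcases min_le_iff.1 h1 with h3 | h3
  · linarith [hm.1]
  · linarith [hm.1, hm.2]

theorem gp_right_le (H : InvHyp D d) (hf : 2 * c + d < D 1 f) (hm : Marker D f c x y h) :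
    gp D (h * f) x y ≤ c + d := by
  have h1 := H.min_gp_le (h * f) h x y
  have h2 := H.gp_add h (h * f) x
  rw [dist_eq H, H.gp_symm h (h * f) x] at h2
  rcases min_le_iff.1 h1 with h3 | h3
  · linarith [hm.1, hm.2]
  · linarith [hm.2]

theorem dist_right_le (H : InvHyp D d) (x h f : G) : D x (h * f) ≤ D x h + D 1 f := by
  have := H.tri x h (h * f)
  rwa [dist_eq H] at this

theorem dist_right_eq (H : InvHyp D d) (x h f : G) :
    D x (h * f) = D x h + D 1 f - 2 * gp D h x (h * f) := by
  unfold gp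
  rw [dist_eq H, H.symm h x]; ring

/-- A marker remains one when the far endpoint is replaced by a point projecting beyond it. -/
theorem right_of_lt (H : InvHyp D d) (hm : Marker D f c x y h) {w : G}
    (hw : D x h + D 1 f + c + d < gp D x w y) : gp D (h * f) h w ≤ c + d := by
  rcases H.gp_right_or (h * f) h y w hm.2 with h1 | h1
  · exact h1
  · have := H.gp_ge_sub x y (h * f) w
    have := dist_right_le H x h f
    linarith

/-- A marker remains one when the near endpoint is replaced by a point projecting before it. -/
theorem left_of_lt (H : InvHyp D d) (hf : 2 * c + d < D 1 f) (hm : Marker D f c x y h) {v : G}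
    (hv : gp D x v y < D x h - 3 * (c + d)) : gp D h v (h * f) ≤ c + d := by
  have h0 : gp D h (h * f) x ≤ c := by rw [H.gp_symm]; exact hm.1
  rcases H.gp_right_or h (h * f) x v h0 with h1 | h1
  · rwa [H.gp_symm]
  · have h2 := H.gp_ge_sub y x h v
    have h3 := gp_left_le H hf hm
    unfold gp at *
    rw [H.symm h x, H.symm h y] at *
    rw [H.symm y x] at *
    rw [H.symm y v] at *
    linarith [H.symm x v, H.symm h v]

theorem of_between (H : InvHyp D d) (hf : 2 * c + d < D 1 f) (hm : Marker D f c x y h) {v w : G}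
    (hv : gp D x v y < D x h - 3 * (c + d)) (hw : D x h + D 1 f + c + d < gp D x w y) :
    Marker D f (c + d) v w h :=
  ⟨left_of_lt H hf hm hv, right_of_lt H hm hw⟩

/-- The far end of a marker is at distance at most that of the endpoint, up to an error. -/
theorem dist_le (H : InvHyp D d) (hf : 2 * c + d < D 1 f) (hm : Marker D f c x y h) :
    D x h ≤ D x y + 2 * (c + d) := by
  have h1 := gp_left_le H hf hm
  unfold gp at h1
  rw [H.symm h x] at h1
  linarith [H.nonneg h y]

theorem sub_le_gp (H : InvHyp D d) (hf : 2 * c + d < D 1 f) (hm : Marker D f c x y h) :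
    D x h - (c + d) ≤ gp D x h y := by
  have h1 := gp_left_le H hf hm
  have := H.gp_add x h y
  linarith

theorem dist_markers (H : InvHyp D d) (hf : 2 * c + d < D 1 f) {h' : G}
    (hm : Marker D f c x y h) (hm' : Marker D f c x y h') (hpos : |D x h - D x h'| ≤ 1) :
    D h h' ≤ 1 + 4 * c + 4 * d ∧ D (h * f) (h' * f) ≤ 1 + 4 * c + 4 * d := by
  have h0 := H.gp_nonneg h x (h * f)
  have h0' := H.gp_nonneg h' x (h' * f)
  have hc : 0 ≤ c := h0.trans hm.1
  have h1 := H.dist_le_of_gp_le (gp_left_le H hf hm) (gp_left_le H hf hm')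
  have h2 := H.dist_le_of_gp_le (gp_right_le H hf hm) (gp_right_le H hf hm')
  rw [max_self] at h1 h2
  refine ⟨by linarith, ?_⟩
  have h3 : |D x (h * f) - D x (h' * f)| ≤ 1 + 2 * c := by
    rw [dist_right_eq H, dist_right_eq H x h' f]
    rw [abs_le] at hpos ⊢
    constructor <;> linarith [hm.1, hm'.1]
  linarith

end Marker

/-! ### Word lengths -/

/-- The properties of a word length on a finitely generated group. -/
structure WordNorm (len : G → ℕ) : Prop where
  one : len 1 = 0
  mul_le : ∀ g h, len (g * h) ≤ len g + len h
  inv : ∀ g, len g⁻¹ = len g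
  finite : ∀ n, {g | len g ≤ n}.Finite
  parent : ∀ g n, len g = n + 1 → ∃ g', len g' = n ∧ len (g'⁻¹ * g) ≤ 1

section WordLength

variable {S : Finset G} (hS : Subgroup.closure (S : Set G) = ⊤)

theorem wordLength_le {l : List G} (hl : ∀ x ∈ l, x ∈ S ∨ x⁻¹ ∈ S) :
    wordLength S l.prod ≤ l.length :=
  Nat.sInf_le ⟨l, rfl, hl, rfl⟩

include hS in
theorem exists_word (g : G) :
    ∃ l : List G, l.length = wordLength S g ∧ (∀ x ∈ l, x ∈ S ∨ x⁻¹ ∈ S) ∧ l.prod = g := by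
  have hne : {n | ∃ l : List G, l.length = n ∧ (∀ x ∈ l, x ∈ S ∨ x⁻¹ ∈ S) ∧ l.prod = g}.Nonempty := by
    have hg : g ∈ Subgroup.closure (S : Set G) := hS ▸ Subgroup.mem_top g
    rw [← Subgroup.mem_toSubmonoid, Subgroup.closure_toSubmonoid] at hg
    obtain ⟨l, hl, hp⟩ := Submonoid.exists_list_of_mem_closure hg
    exact ⟨_, l, rfl, fun x hx => by simpa using hl x hx, hp⟩
  exact Nat.sInf_mem hne

theorem wordLength_le_one {s : G} (hs : s ∈ S ∨ s = 1) : wordLength S s ≤ 1 := by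
  rcases hs with hs | rfl
  · simpa using wordLength_le (S := S) (l := [s]) (by simp [hs])
  · exact (wordLength_le (S := S) (l := []) (by simp)).trans (by simp)

include hS in
theorem wordNorm_wordLength : WordNorm (wordLength S) where
  one := by simpa using wordLength_le (S := S) (l := []) (by simp)
  mul_le g h := by
    obtain ⟨l, hl, hl', rfl⟩ := exists_word hS g
    obtain ⟨m, hm, hm', rfl⟩ := exists_word hS h
    rw [← hl, ← hm, ← List.prod_append, ← List.length_append]
    refine wordLength_le fun x hx => ?_
    rcases List.mem_append.1 hx with h | h
    exacts [hl' x h, hm' x h]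
  inv := by
    have key : ∀ g, wordLength S g⁻¹ ≤ wordLength S g := by
      intro g
      obtain ⟨l, hl, hl', rfl⟩ := exists_word hS g
      rw [← hl, List.prod_inv_reverse]
      refine (wordLength_le fun x hx => ?_).trans (by simp)
      rw [List.mem_reverse, List.mem_map] at hx
      obtain ⟨y, hy, rfl⟩ := hx
      rw [inv_inv]
      exact (hl' y hy).symm
    exact fun g => le_antisymm (key g) (by simpa using key g⁻¹)
  finite n := by
    classical
    induction n with
    | zero =>
      refine (Set.finite_singleton (1 : G)).subset fun g hg => ?_
      obtain ⟨l, hl, -, rfl⟩ := exists_word hS g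
      have : l = [] := List.length_eq_zero_iff.1 (by simpa [hl] using hg)
      simp [this]
    | succ n ih =>
      refine ((ih.mul (S ∪ S.image fun x => x⁻¹ : Finset G).finite_toSet).union ih).subset
        fun g hg => ?_
      obtain ⟨l, hl, hl', rfl⟩ := exists_word hS g
      rcases List.eq_nil_or_concat l with rfl | ⟨l', a, rfl⟩
      · right
        simpa using (wordLength_le (S := S) (l := []) (by simp)).trans (Nat.zero_le n)
      · left
        rw [List.concat_eq_append] at *
        rw [List.prod_append, List.prod_singleton]
        refine Set.mul_mem_mul ?_ ?_
        · have h1 : wordLength S l'.prod ≤ l'.length :=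
            wordLength_le fun x hx => hl' x (by simp [hx])
          have h2 : (l' ++ [a]).length ≤ n + 1 := hl ▸ hg
          simp at h2
          exact h1.trans h2
        · have := hl' a (by simp)
          simp only [Finset.coe_union, Finset.coe_image, Set.mem_union, Set.mem_image,
            Finset.mem_coe]
          exact this.imp id fun h => ⟨_, h, inv_inv a⟩
  parent g n hg := by
    obtain ⟨l, hl, hl', rfl⟩ := exists_word hS g
    rcases List.eq_nil_or_concat l with rfl | ⟨l', a, rfl⟩
    · have := wordLength_le (S := S) (l := []) (by simp)
      simp only [List.length_nil] at this
      omega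
    · rw [List.concat_eq_append] at *
      have ha := hl' a (by simp)
      have h1 : wordLength S l'.prod ≤ l'.length :=
        wordLength_le fun x hx => hl' x (by simp [hx])
      have h2 : wordLength S a ≤ 1 := by
        simpa using wordLength_le (S := S) (l := [a]) (by simpa using ha)
      obtain ⟨m, hm, hm', hm''⟩ := exists_word hS l'.prod
      have h3 : wordLength S (l' ++ [a]).prod ≤ m.length + 1 := by
        rw [List.prod_append, ← hm'', ← List.prod_append]
        refine (wordLength_le fun x hx => ?_).trans (by simp)
        rcases List.mem_append.1 hx with h | h
        · exact hm' x h
        · rw [List.mem_singleton] at h; exact h ▸ ha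
      refine ⟨l'.prod, ?_, by simpa using h2⟩
      simp only [List.length_append, List.length_singleton] at hl
      omega

end WordLength

namespace WordNorm

variable {len : G → ℕ} (W : WordNorm len)

/-- The ball of radius `n` as a finset. -/
noncomputable def fball (n : ℕ) : Finset G := (W.finite n).toFinset

/-- The number of elements of length at most `n`. -/
noncomputable def growth (n : ℕ) : ℕ := (W.fball n).card

@[simp] theorem mem_fball {n : ℕ} {g : G} : g ∈ W.fball n ↔ len g ≤ n := by
  simp [fball]

theorem growth_pos (n : ℕ) : 0 < W.growth n :=
  Finset.card_pos.2 ⟨1, by simp [W.one]⟩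

theorem growth_mono {m n : ℕ} (h : m ≤ n) : W.growth m ≤ W.growth n :=
  Finset.card_le_card fun g hg => by
    rw [mem_fball] at *; exact hg.trans h

include W in
theorem len_comm (g h : G) : len (g⁻¹ * h) = len (h⁻¹ * g) := by
  rw [← W.inv (g⁻¹ * h)]; simp

include W in
theorem len_tri (g h k : G) : len (g⁻¹ * k) ≤ len (g⁻¹ * h) + len (h⁻¹ * k) := by
  have := W.mul_le (g⁻¹ * h) (h⁻¹ * k)
  simpa [mul_assoc] using this

open Classical in
/-- A chosen neighbour of `g` one step closer to the identity. -/
noncomputable def par (W : WordNorm len) (g : G) : G :=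
  if h : len g = (len g - 1) + 1 then (W.parent g _ h).choose else g

theorem len_par (g : G) : len (W.par g) = len g - 1 := by
  unfold par
  split_ifs with h
  · exact (W.parent g _ h).choose_spec.1
  · omega

theorem len_par_inv_mul (g : G) : len ((W.par g)⁻¹ * g) ≤ 1 := by
  unfold par
  split_ifs with h
  · exact (W.parent g _ h).choose_spec.2
  · simp [W.one]

/-- The vertex at distance `t` from the identity on a chosen geodesic from the identity to `g`. -/
noncomputable def pre (g : G) (t : ℕ) : G := W.par^[len g - t] g

theorem len_iterate_par (g : G) (k : ℕ) : len (W.par^[k] g) = len g - k := by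
  induction k with
  | zero => simp
  | succ k ih => rw [Function.iterate_succ_apply', W.len_par, ih]; omega

theorem len_pre {g : G} {t : ℕ} (h : t ≤ len g) : len (W.pre g t) = t := by
  rw [pre, W.len_iterate_par]; omega

@[simp] theorem pre_len (g : G) : W.pre g (len g) = g := by simp [pre]

theorem pre_pre {g : G} {s t : ℕ} (hst : s ≤ t) (ht : t ≤ len g) :
    W.pre (W.pre g t) s = W.pre g s := by
  rw [pre, len_pre W ht, pre, ← Function.iterate_add_apply, pre]
  congr 1; omega

theorem len_pre_step (g : G) (t : ℕ) : len ((W.pre g t)⁻¹ * W.pre g (t + 1)) ≤ 1 := by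
  by_cases h : t < len g
  · have : len g - t = (len g - (t + 1)) + 1 := by omega
    rw [pre, pre, this, Function.iterate_succ_apply']
    exact W.len_par_inv_mul _
  · have : len g - t = len g - (t + 1) := by omega
    rw [pre, pre, this]
    simp [W.one]

theorem len_pre_le {g : G} (s k : ℕ) : len ((W.pre g s)⁻¹ * W.pre g (s + k)) ≤ k := by
  induction k with
  | zero => simp [W.one]
  | succ k ih =>
    refine (W.len_tri _ (W.pre g (s + k)) _).trans ?_
    have := W.len_pre_step g (s + k)
    rw [add_assoc] at this
    omega

theorem len_pre_inv_mul {g : G} {s t : ℕ} (hst : s ≤ t) (ht : t ≤ len g) :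
    len ((W.pre g s)⁻¹ * W.pre g t) = t - s := by
  refine le_antisymm ?_ ?_
  · obtain ⟨k, rfl⟩ := Nat.exists_eq_add_of_le hst
    simpa using W.len_pre_le s k
  · have := W.mul_le (W.pre g s) ((W.pre g s)⁻¹ * W.pre g t)
    rw [mul_inv_cancel_left, len_pre W ht, len_pre W (hst.trans ht)] at this
    omega

theorem len_pre_inv_mul_self {g : G} {s : ℕ} (hs : s ≤ len g) :
    len ((W.pre g s)⁻¹ * g) = len g - s := by
  have := W.len_pre_inv_mul hs le_rfl
  rwa [pre_len] at this

theorem growth_add_le (a b : ℕ) : W.growth (a + b) ≤ W.growth a * W.growth b := by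
  classical
  rw [growth, growth, growth, ← Finset.card_product]
  refine Finset.card_le_card_of_surjOn (fun p => p.1 * p.2) fun g hg => ?_
  rw [Finset.mem_coe, mem_fball] at hg
  by_cases h : a ≤ len g
  · refine ⟨(W.pre g a, (W.pre g a)⁻¹ * g), ?_, by simp⟩
    simp only [Finset.coe_product, Set.mem_prod, Finset.mem_coe, mem_fball]
    exact ⟨(W.len_pre h).le, by rw [W.len_pre_inv_mul_self h]; omega⟩
  · refine ⟨(g, 1), ?_, by simp⟩
    simp only [Finset.coe_product, Set.mem_prod, Finset.mem_coe, mem_fball, W.one]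
    omega

end WordNorm

/-! ### Markers of a contracting element -/

/-- A word norm `len` and a hyperbolic left-invariant pseudo-metric `D`, together with an element
`f` whose translates act as markers: few markers are close to each other, and a marker can be
inserted between any two elements, up to correcting by an element of `S₁`. -/
structure MarkerSystem (len : G → ℕ) (D : G → G → ℝ) (d c K : ℝ) (f : G) (S₁ : Finset G) :
    Prop where
  word : WordNorm len
  hyp : InvHyp D d
  d_pos : 0 < d
  c_pos : 0 < c
  K_pos : 0 < K
  lip : ∀ g h, D g h ≤ K * len (g⁻¹ * h)
  long : 20 * (c + 3 * d) < D 1 f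
  fin : {h | D 1 h ≤ 1 + 4 * (c + 3 * d) + 4 * d ∧
    D f (h * f) ≤ 1 + 4 * (c + 3 * d) + 4 * d}.Finite
  len_corr : ∀ s ∈ S₁, len s ≤ 1
  corr_left : ∀ g, ∃ s ∈ S₁, gp D 1 f (s * g) ≤ c
  corr_right : ∀ g, ∃ s ∈ S₁, gp D 1 f⁻¹ (s * g) ≤ c
  superlinear : ∀ A B : ℕ, ∃ a, A * (a + B) ≤ word.growth a

namespace MarkerSystem

variable {len : G → ℕ} {D : G → G → ℝ} {d c K : ℝ} {f : G} {S₁ : Finset G}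
  (M : MarkerSystem len D d c K f S₁)
include M

theorem exists_window_bound : ∃ B : ℕ, ∀ (x y : G) (t : ℝ),
    {h | Marker D f (c + 3 * d) x y h ∧ t ≤ D x h ∧ D x h ≤ t + 1}.Finite ∧
    {h | Marker D f (c + 3 * d) x y h ∧ t ≤ D x h ∧ D x h ≤ t + 1}.ncard ≤ B := by
  have H := M.hyp
  refine ⟨{h | D 1 h ≤ 1 + 4 * (c + 3 * d) + 4 * d ∧
    D f (h * f) ≤ 1 + 4 * (c + 3 * d) + 4 * d}.ncard, fun x y t => ?_⟩
  rcases Set.eq_empty_or_nonempty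
    {h | Marker D f (c + 3 * d) x y h ∧ t ≤ D x h ∧ D x h ≤ t + 1} with he | ⟨h₀, hm₀, h1, h2⟩
  · rw [he]; simp
  · have hmaps : ∀ h ∈ {h | Marker D f (c + 3 * d) x y h ∧ t ≤ D x h ∧ D x h ≤ t + 1},
        h₀⁻¹ * h ∈ {h | D 1 h ≤ 1 + 4 * (c + 3 * d) + 4 * d ∧
          D f (h * f) ≤ 1 + 4 * (c + 3 * d) + 4 * d} := by
      rintro h ⟨hm, h3, h4⟩
      have hc := M.c_pos
      have hd := M.d_pos
      obtain ⟨h5, h6⟩ := hm₀.dist_markers H (by linarith [M.long]) hm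
        (by rw [abs_le]; constructor <;> linarith)
      rw [← H.inv h₀⁻¹] at h5 h6
      simp only [inv_mul_cancel, ← mul_assoc, one_mul] at h5 h6
      exact ⟨h5, h6⟩
    have hinj : Set.InjOn (fun h => h₀⁻¹ * h)
        {h | Marker D f (c + 3 * d) x y h ∧ t ≤ D x h ∧ D x h ≤ t + 1} :=
      (mul_right_injective h₀⁻¹).injOn
    exact ⟨Set.Finite.of_injOn hmaps hinj M.fin, Set.ncard_le_ncard_of_injOn _ hmaps hinj M.fin⟩

theorem exists_window_bound' : ∃ B : ℕ, ∀ (x y : G) (t : ℝ) (Q : ℕ),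
    {h | Marker D f (c + 3 * d) x y h ∧ t ≤ D x h ∧ D x h ≤ t + Q}.Finite ∧
    {h | Marker D f (c + 3 * d) x y h ∧ t ≤ D x h ∧ D x h ≤ t + Q}.ncard ≤ B * (Q + 1) := by
  obtain ⟨B, hB⟩ := M.exists_window_bound
  refine ⟨B, fun x y t Q => ?_⟩
  induction Q with
  | zero =>
    have hsub : {h | Marker D f (c + 3 * d) x y h ∧ t ≤ D x h ∧ D x h ≤ t + (0 : ℕ)} ⊆
        {h | Marker D f (c + 3 * d) x y h ∧ t ≤ D x h ∧ D x h ≤ t + 1} := by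
      rintro h ⟨h1, h2, h3⟩
      push_cast at h3
      exact ⟨h1, h2, by linarith⟩
    obtain ⟨h1, h2⟩ := hB x y t
    exact ⟨h1.subset hsub, by simpa using (Set.ncard_le_ncard hsub h1).trans h2⟩
  | succ Q ih =>
    have hsub : {h | Marker D f (c + 3 * d) x y h ∧ t ≤ D x h ∧ D x h ≤ t + (Q + 1 : ℕ)} ⊆
        {h | Marker D f (c + 3 * d) x y h ∧ t ≤ D x h ∧ D x h ≤ t + Q} ∪
        {h | Marker D f (c + 3 * d) x y h ∧ t + Q ≤ D x h ∧ D x h ≤ t + Q + 1} := by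
      rintro h ⟨h1, h2, h3⟩
      push_cast at h3
      rcases le_total (D x h) (t + Q) with h4 | h4
      · exact Or.inl ⟨h1, h2, h4⟩
      · exact Or.inr ⟨h1, h4, by linarith⟩
    obtain ⟨h1, h2⟩ := hB x y (t + Q)
    refine ⟨(ih.1.union h1).subset hsub, ?_⟩
    have h3 := Set.ncard_le_ncard hsub (ih.1.union h1)
    have h4 := Set.ncard_union_le
        {h | Marker D f (c + 3 * d) x y h ∧ t ≤ D x h ∧ D x h ≤ t + Q}
        {h | Marker D f (c + 3 * d) x y h ∧ t + Q ≤ D x h ∧ D x h ≤ t + Q + 1}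
    have : B * (Q + 1 + 1) = B * (Q + 1) + B := by ring
    omega

theorem exists_card_markers : ∃ B : ℕ, ∀ x y : G,
    {h | Marker D f (c + 3 * d) x y h}.Finite ∧
    {h | Marker D f (c + 3 * d) x y h}.ncard ≤ B * (len (x⁻¹ * y) + 1) := by
  obtain ⟨B, hB⟩ := M.exists_window_bound'
  refine ⟨B * (⌈K⌉₊ + ⌈2 * ((c + 3 * d) + d)⌉₊ + 1), fun x y => ?_⟩
  have hsub : {h | Marker D f (c + 3 * d) x y h} ⊆
      {h | Marker D f (c + 3 * d) x y h ∧ (0 : ℝ) ≤ D x h ∧ D x h ≤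
        0 + (⌈K⌉₊ * len (x⁻¹ * y) + ⌈2 * ((c + 3 * d) + d)⌉₊ : ℕ)} := by
    intro h hm
    refine ⟨hm, M.hyp.nonneg _ _, ?_⟩
    have h1 := hm.dist_le M.hyp (by linarith [M.long, M.c_pos, M.d_pos])
    have h2 := M.lip x y
    have h3 := Nat.le_ceil (2 * ((c + 3 * d) + d))
    have h4 : K * len (x⁻¹ * y) ≤ ⌈K⌉₊ * len (x⁻¹ * y) := by gcongr; exact Nat.le_ceil K
    push_cast
    linarith
  obtain ⟨h1, h2⟩ := hB x y 0 (⌈K⌉₊ * len (x⁻¹ * y) + ⌈2 * ((c + 3 * d) + d)⌉₊)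
  refine ⟨h1.subset hsub, (Set.ncard_le_ncard hsub h1).trans (h2.trans ?_)⟩
  rw [mul_assoc]
  gcongr
  nlinarith

theorem exists_len_marker_le (n : ℕ) : ∃ R : ℕ, ∀ v w h : G, len (v⁻¹ * w) ≤ n →
    Marker D f (c + 3 * d) v w h → len (v⁻¹ * h) ≤ R := by
  obtain ⟨B, hB⟩ := M.exists_card_markers
  have hfin : (⋃ u ∈ {g | len g ≤ n}, {h | Marker D f (c + 3 * d) 1 u h}).Finite :=
    (M.word.finite n).biUnion fun u _ => (hB 1 u).1
  obtain ⟨R, hR⟩ := (hfin.image len).bddAbove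
  refine ⟨R, fun v w h hl hm => hR ⟨v⁻¹ * h, ?_, rfl⟩⟩
  rw [← Marker.inv_iff M.hyp v⁻¹, inv_mul_cancel] at hm
  exact Set.mem_biUnion (x := v⁻¹ * w) hl hm

theorem exists_insert (p w : G) : ∃ s ∈ S₁, ∃ t ∈ S₁,
    Marker D f c 1 (p * s⁻¹ * f * t * w) (p * s⁻¹) := by
  obtain ⟨s, hs, h1⟩ := M.corr_left p⁻¹
  obtain ⟨t, ht, h2⟩ := M.corr_right w
  refine ⟨s, hs, t, ht, ?_, ?_⟩
  · rw [← M.hyp.gp_inv (p * s⁻¹)⁻¹, M.hyp.gp_symm]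
    simpa [mul_assoc] using h1
  · rw [← M.hyp.gp_inv (p * s⁻¹ * f)⁻¹]
    simpa [mul_assoc] using h2

theorem len_insert_le {p w s t : G} (hs : s ∈ S₁) (ht : t ∈ S₁) :
    len (p * s⁻¹ * f * t * w) ≤ len p + len w + (len f + 2) := by
  have h1 := M.word.mul_le (p * s⁻¹ * f * t) w
  have h2 := M.word.mul_le (p * s⁻¹ * f) t
  have h3 := M.word.mul_le (p * s⁻¹) f
  have h4 := M.word.mul_le p s⁻¹
  have h5 := M.len_corr s hs
  have h6 := M.len_corr t ht
  rw [M.word.inv] at h4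
  omega

/-- Counting pairs through the elements obtained by inserting a marker between them. -/
theorem card_pairs_le (A : Finset (G × G)) (n B : ℕ)
    (hA : ∀ a ∈ A, len a.1 + len a.2 + (len f + 2) ≤ n)
    (hB : ∀ g, {h | ∃ a ∈ A, ∃ s ∈ S₁, ∃ t ∈ S₁, a.1 * s⁻¹ = h ∧ h * f * t * a.2 = g ∧
      Marker D f c 1 g h}.ncard ≤ B) :
    A.card ≤ M.word.growth n * B * S₁.card ^ 2 := by
  classical
  have hins : ∀ a : G × G, ∃ s ∈ S₁, ∃ t ∈ S₁,
      Marker D f c 1 (a.1 * s⁻¹ * f * t * a.2) (a.1 * s⁻¹) := fun a => M.exists_insert _ _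
  choose s hs t ht hm using hins
  have key := Finset.card_le_mul_card_image_of_maps_to (s := A) (t := M.word.fball n)
    (f := fun a => a.1 * (s a)⁻¹ * f * t a * a.2)
    (fun a ha => by
      rw [WordNorm.mem_fball]
      exact (M.len_insert_le (hs a) (ht a)).trans (hA a ha)) (B * S₁.card ^ 2) ?_
  · calc A.card ≤ _ := key
      _ = _ := by rw [WordNorm.growth]; ring
  · intro g _
    set T := {h | ∃ a ∈ A, ∃ s ∈ S₁, ∃ t ∈ S₁, a.1 * s⁻¹ = h ∧ h * f * t * a.2 = g ∧
      Marker D f c 1 g h} with hT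
    have hTfin : T.Finite := by
      refine ((A ×ˢ S₁).finite_toSet.image fun x => x.1.1 * x.2⁻¹).subset ?_
      rintro h ⟨a, ha, s, hs, t, ht, h1, -⟩
      exact ⟨(a, s), by simp [ha, hs], h1⟩
    have hle : (A.filter fun a => a.1 * (s a)⁻¹ * f * t a * a.2 = g).card ≤
        (hTfin.toFinset ×ˢ S₁ ×ˢ S₁).card := by
      refine Finset.card_le_card_of_injOn (fun a => (a.1 * (s a)⁻¹, s a, t a)) ?_ ?_
      · intro a ha
        simp only [Finset.coe_filter, Set.mem_ofPred_eq] at ha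
        simp only [Finset.coe_product, Set.mem_prod, Finset.mem_coe, Set.Finite.mem_toFinset]
        refine ⟨⟨a, ha.1, s a, hs a, t a, ht a, rfl, ha.2, ?_⟩, hs a, ht a⟩
        have := hm a
        rwa [ha.2] at this
      · intro a ha b hb hab
        simp only [Finset.coe_filter, Set.mem_ofPred_eq] at ha hb
        simp only [Prod.mk.injEq] at hab
        obtain ⟨h1, h2, h3⟩ := hab
        have h4 := ha.2.trans hb.2.symm
        rw [h1, h3] at h4
        refine Prod.ext ?_ (mul_left_cancel h4)
        rw [h2] at h1
        exact mul_right_cancel h1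
    refine hle.trans ?_
    rw [Finset.card_product, Finset.card_product, ← Set.ncard_eq_toFinset_card _ hTfin, ← sq]
    exact Nat.mul_le_mul_right _ (hB g)

theorem exists_supermultiplicative : ∃ C : ℕ, 0 < C ∧ ∀ a b,
    M.word.growth a * M.word.growth b ≤
      C * (a + b + (len f + 2) + 1) * M.word.growth (a + b + (len f + 2)) := by
  obtain ⟨B, hB⟩ := M.exists_card_markers
  refine ⟨B * S₁.card ^ 2 + 1, by omega, fun a b => ?_⟩
  set n := a + b + (len f + 2) with hn
  have h1 := M.card_pairs_le ((M.word.fball a) ×ˢ (M.word.fball b)) n (B * (n + 1))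
    (fun x hx => by
      simp only [Finset.mem_product, WordNorm.mem_fball] at hx
      omega) ?_
  · rw [Finset.card_product] at h1
    calc _ ≤ _ := h1
      _ = (B * S₁.card ^ 2) * (n + 1) * M.word.growth n := by ring
      _ ≤ _ := by gcongr; omega
  · intro g
    rcases Set.eq_empty_or_nonempty {h | ∃ x ∈ (M.word.fball a) ×ˢ (M.word.fball b),
      ∃ s ∈ S₁, ∃ t ∈ S₁, x.1 * s⁻¹ = h ∧ h * f * t * x.2 = g ∧ Marker D f c 1 g h}
      with he | ⟨h, x, hx, s, hs, t, ht, rfl, rfl, -⟩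
    · rw [he]; simp
    · refine (Set.ncard_le_ncard ?_ (hB 1 (x.1 * s⁻¹ * f * t * x.2)).1).trans
        ((hB 1 _).2.trans ?_)
      · rintro h' ⟨_, _, _, _, _, _, _, _, hm⟩
        exact hm.mono (by linarith [M.d_pos])
      · have := M.len_insert_le (p := x.1) (w := x.2) hs ht
        simp only [Finset.mem_product, WordNorm.mem_fball] at hx
        gcongr
        rw [inv_one, one_mul]
        omega

end MarkerSystem

/-! ### Growth of balls -/

namespace MarkerSystem

variable {len : G → ℕ} {D : G → G → ℝ} {d c K : ℝ} {f : G} {S₁ : Finset G}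
  (M : MarkerSystem len D d c K f S₁)
include M

/-- Along a geometric sequence of radii the growth is superpolynomial. -/
theorem exists_growth_ge : ∃ a : ℕ, ∀ k : ℕ,
    2 ^ 2 ^ k ≤ M.word.growth (2 ^ k * a) := by
  obtain ⟨C, hC, hsup⟩ := M.exists_supermultiplicative
  set e := len f + 2 with he
  obtain ⟨a, ha⟩ := M.superlinear (8 * C) (1 + e)
  have key : ∀ k : ℕ, ∃ b, b + e = 2 ^ k * (a + e) ∧
      4 * C * (b + 1 + e) * 2 ^ 2 ^ k ≤ M.word.growth b := by
    intro k
    induction k with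
    | zero =>
      refine ⟨a, by simp, ?_⟩
      refine le_trans (le_of_eq ?_) ha
      ring
    | succ k ih =>
      obtain ⟨b, hb, hg⟩ := ih
      refine ⟨b + b + e, by rw [pow_succ]; linarith, ?_⟩
      have h1 := hsup b b
      have h2 : (4 * C * (b + 1 + e) * 2 ^ 2 ^ k) * (4 * C * (b + 1 + e) * 2 ^ 2 ^ k) ≤
          C * (b + b + e + 1) * M.word.growth (b + b + e) :=
        (Nat.mul_le_mul hg hg).trans h1
      have h3 : C * (b + b + e + 1) * M.word.growth (b + b + e) ≤
          (2 * C * (b + 1 + e)) * M.word.growth (b + b + e) := by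
        gcongr ?_ * _
        nlinarith
      have h4 : (2 : ℕ) ^ 2 ^ (k + 1) = 2 ^ 2 ^ k * 2 ^ 2 ^ k := by
        rw [← pow_add]; congr 1; ring
      rw [h4]
      have h5 : (2 * C * (b + 1 + e)) * (8 * C * (b + 1 + e) * (2 ^ 2 ^ k * 2 ^ 2 ^ k)) ≤
          (2 * C * (b + 1 + e)) * M.word.growth (b + b + e) := by
        refine le_trans (le_of_eq ?_) (h2.trans h3)
        ring
      have h6 := Nat.le_of_mul_le_mul_left h5 (by positivity)
      refine le_trans ?_ h6
      have h7 : 4 * C * (b + b + e + 1 + e) ≤ 8 * C * (b + 1 + e) := by nlinarith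
      exact Nat.mul_le_mul_right _ h7
  refine ⟨a + e, fun k => ?_⟩
  obtain ⟨b, hb, hg⟩ := key k
  calc 2 ^ 2 ^ k ≤ 4 * C * (b + 1 + e) * 2 ^ 2 ^ k :=
        Nat.le_mul_of_pos_left _ (by positivity)
    _ ≤ M.word.growth b := hg
    _ ≤ _ := M.word.growth_mono (by omega)

theorem eventually_sq_le_growth (C : ℕ) :
    ∃ n₀ : ℕ, ∀ n ≥ n₀, C * (n + 1) ^ 2 ≤ M.word.growth n := by
  obtain ⟨a, ha⟩ := M.exists_growth_ge
  obtain ⟨k₀, hk₀⟩ : ∃ k₀ : ℕ, ∀ k ≥ k₀, C * (2 * (a + 1)) ^ 2 * (2 ^ k) ^ 2 ≤ 2 ^ 2 ^ k := by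
    obtain ⟨m₀, hm₀⟩ : ∃ m₀ : ℕ, ∀ m ≥ m₀, C * (2 * (a + 1)) ^ 2 * m ^ 2 ≤ 2 ^ m := by
      have h1 := tendsto_pow_const_div_const_pow_of_one_lt 2 (r := (2 : ℝ)) one_lt_two
      have h2 : (0 : ℝ) < 1 / (C * (2 * (a + 1)) ^ 2 + 1) := by positivity
      obtain ⟨m₀, hm₀⟩ := Filter.eventually_atTop.1 (h1.eventually_lt_const h2)
      refine ⟨m₀, fun m hm => ?_⟩
      have h3 := hm₀ m hm
      rw [div_lt_div_iff₀ (by positivity) (by positivity)] at h3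
      have : ((C * (2 * (a + 1)) ^ 2 * m ^ 2 : ℕ) : ℝ) ≤ (2 ^ m : ℕ) := by
        push_cast
        nlinarith [sq_nonneg (m : ℝ)]
      exact_mod_cast this
    exact ⟨m₀, fun k hk => hm₀ _ (hk.le.trans Nat.lt_two_pow_self.le)⟩
  refine ⟨2 ^ k₀ * (a + 1), fun n hn => ?_⟩
  have hpos : 0 < n / (a + 1) := Nat.div_pos
    ((Nat.le_mul_of_pos_left _ (by positivity)).trans hn) (by omega)
  set k := Nat.log 2 (n / (a + 1)) with hk
  have h1 : 2 ^ k ≤ n / (a + 1) := Nat.pow_log_le_self 2 hpos.ne'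
  have h2 : n / (a + 1) < 2 ^ (k + 1) := Nat.lt_pow_succ_log_self (by norm_num) _
  have h3 : 2 ^ k * (a + 1) ≤ n := (Nat.le_div_iff_mul_le (by omega)).1 h1
  have h4 : n < 2 ^ (k + 1) * (a + 1) := (Nat.div_lt_iff_lt_mul (by omega)).1 h2
  have h5 : k₀ ≤ k := by
    refine Nat.le_log_of_pow_le (by norm_num) ?_
    exact (Nat.le_div_iff_mul_le (by omega)).2 hn
  calc C * (n + 1) ^ 2 ≤ C * (2 ^ (k + 1) * (a + 1)) ^ 2 := by gcongr; omega
    _ = C * (2 * (a + 1)) ^ 2 * (2 ^ k) ^ 2 := by ring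
    _ ≤ 2 ^ 2 ^ k := hk₀ k h5
    _ ≤ _ := ha k
    _ ≤ _ := M.word.growth_mono (le_trans (by gcongr; omega) h3)

/-- Balls of radius a definite proportion smaller than `n` are negligible in the ball of
radius `n`. -/
theorem eventually_growth_le {κ : ℝ} (hκ : 0 < κ) (A : ℝ) (C : ℕ) :
    ∃ n₀ : ℕ, ∀ n ≥ n₀, ∀ m : ℕ, (m : ℝ) ≤ (1 - κ) * n + A →
      C * (n + 1) * M.word.growth m ≤ M.word.growth n := by
  obtain ⟨B, hB, hsup⟩ := M.exists_supermultiplicative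
  set e := len f + 2 with he
  obtain ⟨q, hq⟩ := exists_nat_gt (2 / κ)
  have hq0 : 0 < q := by
    have : (0 : ℝ) < q := lt_trans (by positivity) hq
    exact_mod_cast this
  obtain ⟨b₀, hb₀⟩ := M.eventually_sq_le_growth (B * C * (q + 1) ^ 2)
  obtain ⟨n₀, hn₀⟩ := exists_nat_ge ((|A| + e + 1 + b₀) * (2 / κ))
  refine ⟨n₀, fun n hn m hm => ?_⟩
  have hn' : (|A| + e + 1 + b₀) ≤ κ / 2 * n := by
    have : (n₀ : ℝ) ≤ n := by exact_mod_cast hn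
    have h1 := hn₀.trans this
    have h2 : (|A| + e + 1 + b₀) * (2 / κ) * (κ / 2) ≤ n * (κ / 2) := by gcongr
    have h3 : (|A| + e + 1 + b₀) * (2 / κ) * (κ / 2) = |A| + e + 1 + b₀ := by field_simp
    linarith
  have hA := le_abs_self A
  have hm' : ((m + e : ℕ) : ℝ) ≤ n - κ / 2 * n := by push_cast; linarith
  have hmn : m + e ≤ n := by
    have : ((m + e : ℕ) : ℝ) ≤ n := hm'.trans (by have : 0 ≤ κ / 2 * n := by positivity
                                                  linarith)
    exact_mod_cast this
  obtain ⟨b, hb⟩ := Nat.exists_eq_add_of_le hmn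
  have hbr : κ / 2 * n ≤ b := by
    have : (n : ℝ) = (m + e : ℕ) + b := by rw [hb]; push_cast; ring
    linarith
  have hb₀b : b₀ ≤ b := by
    have : (b₀ : ℝ) ≤ b := by have := abs_nonneg A; linarith
    exact_mod_cast this
  have hnb : n ≤ q * b := by
    have : (n : ℝ) ≤ q * b := by
      have h1 : (n : ℝ) = 2 / κ * (κ / 2 * n) := by field_simp
      rw [h1]
      gcongr
    exact_mod_cast this
  have h1 := hsup m b
  have h2 := hb₀ b hb₀b
  have h3 : n = m + b + e := by omega
  rw [← h3] at h1
  have h4 : B * (n + 1) * (C * (n + 1)) ≤ M.word.growth b := by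
    refine le_trans ?_ h2
    calc B * (n + 1) * (C * (n + 1)) = B * C * (n + 1) ^ 2 := by ring
      _ ≤ B * C * ((q + 1) * (b + 1)) ^ 2 := by gcongr; nlinarith
      _ = _ := by ring
  have h5 : B * (n + 1) * (C * (n + 1) * M.word.growth m) ≤ B * (n + 1) * M.word.growth n := by
    calc _ = M.word.growth m * (B * (n + 1) * (C * (n + 1))) := by ring
      _ ≤ M.word.growth m * M.word.growth b := by gcongr
      _ ≤ _ := h1
  exact Nat.le_of_mul_le_mul_left h5 (by positivity)

end MarkerSystem

/-! ### First hitting times -/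

/-- The first time at which `u` reaches the level `σ`. -/
noncomputable def hit (u : ℕ → ℝ) (σ : ℝ) : ℕ := sInf {t | σ ≤ u t}

theorem hit_le {u : ℕ → ℝ} {σ : ℝ} {t : ℕ} (h : σ ≤ u t) : hit u σ ≤ t := Nat.sInf_le h

theorem le_apply_hit {u : ℕ → ℝ} {σ : ℝ} {t : ℕ} (h : σ ≤ u t) : σ ≤ u (hit u σ) :=
  Nat.sInf_mem (s := {t | σ ≤ u t}) ⟨t, h⟩

theorem hit_mono {u : ℕ → ℝ} {σ σ' : ℝ} {t : ℕ} (h : σ' ≤ u t) (hσ : σ ≤ σ') :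
    hit u σ ≤ hit u σ' :=
  hit_le (hσ.trans (le_apply_hit h))

theorem apply_hit_le {u : ℕ → ℝ} {σ K : ℝ} (hu : ∀ t, u (t + 1) ≤ u t + K) (h0 : u 0 < σ)
    {t : ℕ} (h : σ ≤ u t) : u (hit u σ) ≤ σ + K := by
  have h1 := le_apply_hit h
  obtain ⟨s, hs⟩ : ∃ s, hit u σ = s + 1 := by
    refine Nat.exists_eq_succ_of_ne_zero fun h2 => ?_
    rw [h2] at h1
    exact absurd h1 (not_le.2 h0)
  have h2 : ¬ σ ≤ u s := fun h3 => by
    have := hit_le h3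
    omega
  rw [hs]
  linarith [hu s, not_le.1 h2]

/-! ### Chains of markers -/

/-- A sequence of `N` markers between `1` and `y` with gaps at least `Q`. -/
structure MarkerChain (D : G → G → ℝ) (f : G) (c Q : ℝ) (N : ℕ) (y : G) (h : ℕ → G) : Prop where
  marker : ∀ i < N, Marker D f c 1 y (h i)
  gap : ∀ i, i + 1 < N → D 1 (h i) + Q ≤ D 1 (h (i + 1))

namespace MarkerChain

variable {D : G → G → ℝ} {f : G} {c Q : ℝ} {N : ℕ} {y : G} {h : ℕ → G}

theorem mono {c' : ℝ} {N' : ℕ} (hc : MarkerChain D f c Q N y h) (hN : N' ≤ N) (hcc : c ≤ c') :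
    MarkerChain D f c' Q N' y h :=
  ⟨fun i hi => (hc.marker i (hi.trans_le hN)).mono hcc, fun i hi => hc.gap i (hi.trans_le hN)⟩

theorem shift (hc : MarkerChain D f c Q N y h) (a : ℕ) {N' : ℕ} (hN : a + N' ≤ N) :
    MarkerChain D f c Q N' y fun i => h (a + i) :=
  ⟨fun i hi => hc.marker _ (by omega), fun i hi => hc.gap _ (by omega)⟩

theorem add_mul_le (hc : MarkerChain D f c Q N y h) {i j : ℕ} (hij : i + j < N) :
    D 1 (h i) + j * Q ≤ D 1 (h (i + j)) := by
  induction j with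
  | zero => simp
  | succ j ih =>
    have h1 := ih (by omega)
    have h2 := hc.gap (i + j) (by omega)
    rw [← add_assoc]
    push_cast
    linarith

theorem dist_mono (hc : MarkerChain D f c Q N y h) (hQ : 0 ≤ Q) {i j : ℕ} (hij : i ≤ j)
    (hj : j < N) : D 1 (h i) ≤ D 1 (h j) := by
  obtain ⟨k, rfl⟩ := Nat.exists_eq_add_of_le hij
  have := hc.add_mul_le hj
  have : 0 ≤ (k : ℝ) * Q := by positivity
  linarith

theorem add_le (hc : MarkerChain D f c Q N y h) (hQ : 0 ≤ Q) {i j : ℕ} (hij : i < j)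
    (hj : j < N) : D 1 (h i) + Q ≤ D 1 (h j) :=
  (hc.gap i (by omega)).trans (hc.dist_mono hQ hij hj)

end MarkerChain

/-- A sequence of group elements in which consecutive ones are at word distance at most one. -/
def StepPath (len : G → ℕ) (v : ℕ → G) : Prop := ∀ t, len ((v t)⁻¹ * v (t + 1)) ≤ 1

namespace WordNorm

variable {len : G → ℕ} (W : WordNorm len)
include W

theorem len_stepPath {v : ℕ → G} (hv : StepPath len v) {s t : ℕ} (hst : s ≤ t) :
    len ((v s)⁻¹ * v t) ≤ t - s := by
  obtain ⟨k, rfl⟩ := Nat.exists_eq_add_of_le hst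
  rw [Nat.add_sub_cancel_left]
  clear hst
  induction k with
  | zero => simp [W.one]
  | succ k ih =>
    have h1 := W.len_tri (v s) (v (s + k)) (v (s + k + 1))
    have h2 := hv (s + k)
    rw [← add_assoc]
    omega

theorem stepPath_pre (g : G) : StepPath len (W.pre g) := W.len_pre_step g

theorem stepPath_reverse (k g : G) (n : ℕ) : StepPath len fun t => k * W.pre g (n - t) := by
  intro t
  simp only [mul_inv_rev, mul_assoc, inv_mul_cancel_left]
  by_cases h : t < n
  · have : n - t = n - (t + 1) + 1 := by omega
    rw [this, W.len_comm]
    exact W.len_pre_step g _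
  · have : n - t = n - (t + 1) := by omega
    simp [this, W.one]

end WordNorm

namespace MarkerSystem

variable {len : G → ℕ} {D : G → G → ℝ} {d c K : ℝ} {f : G} {S₁ : Finset G}
  (M : MarkerSystem len D d c K f S₁)
include M

/-- Two paths crossing the same long chain of markers, of length linear in the number of markers,
come uniformly close to each other. -/
theorem exists_close {Q : ℝ} (hQ : 2 * D 1 f + 2 * K + 20 * (c + 3 * d) + 2 ≤ Q) (Λ : ℕ) :
    ∃ R : ℕ, ∀ (q : G) (h v v' : ℕ → G) (B m m' : ℕ), 0 < B →
      MarkerChain D f (c + 2 * d) Q (B + 1) q h → StepPath len v → StepPath len v' →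
      gp D 1 (v 0) q < D 1 (h 0) + (D 1 f + (c + 3 * d) + 1) →
      gp D 1 (v' 0) q < D 1 (h 0) + (D 1 f + (c + 3 * d) + 1) →
      D 1 (h B) + (D 1 f + (c + 3 * d) + 1) ≤ gp D 1 (v m) q →
      D 1 (h B) + (D 1 f + (c + 3 * d) + 1) ≤ gp D 1 (v' m') q →
      m + m' ≤ Λ * B →
      ∃ j < B, ∃ t ≤ m, ∃ t' ≤ m',
        D 1 (h j) + (D 1 f + (c + 3 * d) + 1) ≤ gp D 1 (v t) q ∧
        gp D 1 (v t) q ≤ D 1 (h j) + (D 1 f + (c + 3 * d) + 1) + K ∧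
        D 1 (h j) + (D 1 f + (c + 3 * d) + 1) ≤ gp D 1 (v' t') q ∧
        gp D 1 (v' t') q ≤ D 1 (h j) + (D 1 f + (c + 3 * d) + 1) + K ∧
        len ((v t)⁻¹ * v' t') ≤ R := by
  obtain ⟨R, hR⟩ := M.exists_len_marker_le Λ
  refine ⟨2 * R, ?_⟩
  intro q h v v' B m m' hB hc hv hv' h0 h0' hm hm' hmm
  set μ := D 1 f + (c + 3 * d) + 1 with hμ
  have hf := M.long
  have hcp := M.c_pos
  have hdp := M.d_pos
  have hKp := M.K_pos
  have hQ0 : 0 ≤ Q := by linarith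
  have hstep : ∀ w : ℕ → G, StepPath len w → ∀ t, gp D 1 (w (t + 1)) q ≤ gp D 1 (w t) q + K := by
    intro w hw t
    have h1 := M.hyp.gp_sub_le 1 (w (t + 1)) (w t) q
    have h2 := M.lip (w t) (w (t + 1))
    have h3 : (len ((w t)⁻¹ * w (t + 1)) : ℝ) ≤ 1 := by exact_mod_cast hw t
    have h4 : K * len ((w t)⁻¹ * w (t + 1)) ≤ K := by nlinarith
    rw [M.hyp.symm] at h1
    linarith
  have hσ : ∀ i j, i ≤ j → j ≤ B → D 1 (h i) + μ ≤ D 1 (h j) + μ := by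
    intro i j hij hj
    linarith [hc.dist_mono hQ0 hij (Nat.lt_succ_of_le hj)]
  have main : ∀ (w : ℕ → G) (n : ℕ), StepPath len w → gp D 1 (w 0) q < D 1 (h 0) + μ →
      D 1 (h B) + μ ≤ gp D 1 (w n) q → ∃ τ : ℕ → ℕ, (∀ j ≤ B, τ j ≤ n) ∧
        (∀ j < B, τ j ≤ τ (j + 1)) ∧
        (∀ j ≤ B, D 1 (h j) + μ ≤ gp D 1 (w (τ j)) q ∧ gp D 1 (w (τ j)) q ≤ D 1 (h j) + μ + K) ∧
        (∀ j < B, τ (j + 1) - τ j ≤ Λ → len ((w (τ j))⁻¹ * h (j + 1)) ≤ R) := by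
    intro w n hw hw0 hwn
    have hreach : ∀ j ≤ B, D 1 (h j) + μ ≤ gp D 1 (w n) q := fun j hj =>
      (hσ j B hj le_rfl).trans hwn
    have hlow : ∀ j ≤ B, D 1 (h j) + μ ≤ gp D 1 (w (hit (fun t => gp D 1 (w t) q)
        (D 1 (h j) + μ))) q := fun j hj =>
      le_apply_hit (u := fun t => gp D 1 (w t) q) (hreach j hj)
    have hup : ∀ j ≤ B, gp D 1 (w (hit (fun t => gp D 1 (w t) q) (D 1 (h j) + μ))) q ≤
        D 1 (h j) + μ + K := fun j hj =>
      apply_hit_le (u := fun t => gp D 1 (w t) q) (hstep w hw)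
        (hw0.trans_le (hσ 0 j (Nat.zero_le _) hj)) (hreach j hj)
    have hmono : ∀ j < B, hit (fun t => gp D 1 (w t) q) (D 1 (h j) + μ) ≤
        hit (fun t => gp D 1 (w t) q) (D 1 (h (j + 1)) + μ) := fun j hj =>
      hit_mono (u := fun t => gp D 1 (w t) q) (hreach (j + 1) hj) (hσ j (j + 1) (by omega) hj)
    refine ⟨fun j => hit (fun t => gp D 1 (w t) q) (D 1 (h j) + μ), fun j hj =>
      hit_le (u := fun t => gp D 1 (w t) q) (hreach j hj), hmono,
      fun j hj => ⟨hlow j hj, hup j hj⟩, fun j hj hle => ?_⟩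
    refine hR _ _ _ ((M.word.len_stepPath hw (hmono j hj)).trans hle) ?_
    have hmk := hc.marker (j + 1) (by omega)
    have hgap := hc.gap j (by omega)
    refine (hmk.of_between M.hyp (by linarith) ?_ ?_).mono (by linarith)
    · linarith [hup j hj.le]
    · linarith [hlow (j + 1) hj]
  obtain ⟨τ, hτm, hτ, hτψ, hτR⟩ := main v m hv h0 hm
  obtain ⟨τ', hτm', hτ', hτψ', hτR'⟩ := main v' m' hv' h0' hm'
  obtain ⟨j, hj, hjle⟩ : ∃ j < B, (τ (j + 1) - τ j) + (τ' (j + 1) - τ' j) ≤ Λ := by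
    by_contra! hcon
    have hsum : ∀ k ≤ B, (Λ + 1) * k + τ 0 + τ' 0 ≤ τ k + τ' k := by
      intro k
      induction k with
      | zero => intro _; omega
      | succ k ih =>
        intro hk
        have h1 := ih (by omega)
        have h2 := hcon k hk
        have h3 := hτ k hk
        have h4 := hτ' k hk
        rw [mul_add]
        omega
    have h1 := hsum B le_rfl
    have h2 := hτm B le_rfl
    have h3 := hτm' B le_rfl
    rw [add_mul] at h1
    omega
  have h1 := hτR j hj (by omega)
  have h2 := hτR' j hj (by omega)
  refine ⟨j, hj, τ j, hτm j hj.le, τ' j, hτm' j hj.le, (hτψ j hj.le).1, (hτψ j hj.le).2,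
    (hτψ' j hj.le).1, (hτψ' j hj.le).2, ?_⟩
  have h3 := M.word.len_tri (v (τ j)) (h (j + 1)) (v' (τ' j))
  rw [M.word.len_comm (h (j + 1))] at h3
  omega

end MarkerSystem

/-! ### Most elements carry a long chain of markers -/

/-- A large finite set with few elements in each window of length `Q` contains a long sequence
with gaps at least `Q`. -/
theorem exists_gap_sequence {α : Type*} (pos : α → ℝ) (Q : ℝ) (B : ℕ) (N : ℕ) :
    ∀ T : Finset α, (∀ (U : Finset α) (t : ℝ), U ⊆ T → (∀ a ∈ U, t ≤ pos a ∧ pos a ≤ t + Q) →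
      U.card ≤ B) → N * B < T.card →
      ∃ h : ℕ → α, (∀ i ≤ N, h i ∈ T) ∧ ∀ i < N, pos (h i) + Q ≤ pos (h (i + 1)) := by
  classical
  induction N with
  | zero =>
    intro T _ hT
    obtain ⟨a, ha⟩ := Finset.card_pos.1 (lt_of_le_of_lt (Nat.zero_le _) hT)
    exact ⟨fun _ => a, fun _ _ => ha, fun i hi => absurd hi (Nat.not_lt_zero i)⟩
  | succ N ih =>
    intro T hB hT
    have hne : T.Nonempty := Finset.card_pos.1 (lt_of_le_of_lt (Nat.zero_le _) hT)
    obtain ⟨a, ha, hmin⟩ := T.exists_min_image pos hne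
    have h1 : (T.filter fun b => pos b ≤ pos a + Q).card ≤ B := by
      refine hB _ (pos a) (Finset.filter_subset _ _) fun b hb => ?_
      rw [Finset.mem_filter] at hb
      exact ⟨hmin b hb.1, hb.2⟩
    have h2 := Finset.card_filter_add_card_filter_not (s := T) fun b => pos b ≤ pos a + Q
    obtain ⟨h, hh, hgap⟩ := ih (T.filter fun b => ¬ pos b ≤ pos a + Q)
      (fun U t hU => hB U t (hU.trans (Finset.filter_subset _ _))) (by
        rw [add_mul] at hT
        omega)
    refine ⟨fun i => Nat.casesOn i a h, ?_, ?_⟩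
    · rintro (_ | i) hi
      · exact ha
      · exact (Finset.mem_filter.1 (hh i (by omega))).1
    · rintro (_ | i) hi
      · exact (not_le.1 (Finset.mem_filter.1 (hh 0 (Nat.zero_le _))).2).le
      · exact hgap i (by omega)

namespace MarkerSystem

variable {len : G → ℕ} {D : G → G → ℝ} {d c K : ℝ} {f : G} {S₁ : Finset G}
  (M : MarkerSystem len D d c K f S₁)
include M

theorem dist_one_pre_zero (g : G) : D 1 (M.word.pre g 0) = 0 := by
  refine le_antisymm ?_ (M.hyp.nonneg _ _)
  have h1 := M.lip 1 (M.word.pre g 0)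
  rwa [inv_one, one_mul, M.word.len_pre (Nat.zero_le _), Nat.cast_zero, mul_zero] at h1

theorem dist_le_of_len_le {g h : G} {n : ℕ} (hn : len (g⁻¹ * h) ≤ n) : D g h ≤ K * n := by
  have hK := M.K_pos
  refine (M.lip g h).trans ?_
  gcongr

/-- An element without a chain of `⌈ε * n⌉` markers admits few marker insertions along a
geodesic with a prescribed outcome. -/
theorem exists_few_insertions {Q : ℕ}
    (hQ : 2 * D 1 f + 2 * K + 20 * (c + 3 * d) + 2 ≤ (Q : ℝ)) {ε' : ℝ} (hε' : 0 < ε') :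
    ∃ ε : ℝ, 0 < ε ∧ ∃ n₀ : ℕ, ∀ n ≥ n₀, ∀ g' : G,
      ({h | ∃ g i s t, s ∈ S₁ ∧ t ∈ S₁ ∧ len g ≤ n ∧ i ≤ len g ∧
        (¬ ∃ k : ℕ → G, MarkerChain D f (c + 2 * d) Q ⌈ε * n⌉₊ g k) ∧
        M.word.pre g i * s⁻¹ = h ∧ h * f * t * ((M.word.pre g i)⁻¹ * g) = g' ∧
        Marker D f c 1 g' h}.ncard : ℝ) ≤ ε' * n := by
  obtain ⟨B₁, hB₁⟩ := M.exists_window_bound'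
  set B₀ := B₁ * (Q + 1) + 1 with hB₀
  set ε := ε' / (8 * B₀) with hε
  have hB₀pos : (0 : ℝ) < B₀ := by rw [hB₀]; positivity
  have hεpos : 0 < ε := by positivity
  obtain ⟨R, hR⟩ := M.exists_close hQ ⌈1 / ε⌉₊
  have hf := M.long
  have hcp := M.c_pos
  have hdp := M.d_pos
  have hKp := M.K_pos
  have hQ0 : (0 : ℝ) ≤ Q := Nat.cast_nonneg Q
  obtain ⟨n₁, hn₁⟩ := exists_nat_ge (16 * B₀ / ε')
  obtain ⟨n₂, hn₂⟩ := exists_nat_ge ((D 1 f + (c + 3 * d) + 1 + 2 * K + (c + d) + K * R) / ε)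
  refine ⟨ε, hεpos, max n₁ n₂, fun n hn g' => ?_⟩
  by_contra hcon
  rw [not_le] at hcon
  set T := {h | ∃ g i s t, s ∈ S₁ ∧ t ∈ S₁ ∧ len g ≤ n ∧ i ≤ len g ∧
        (¬ ∃ k : ℕ → G, MarkerChain D f (c + 2 * d) Q ⌈ε * n⌉₊ g k) ∧
        M.word.pre g i * s⁻¹ = h ∧ h * f * t * ((M.word.pre g i)⁻¹ * g) = g' ∧
        Marker D f c 1 g' h} with hT
  have hTm : ∀ h ∈ T, Marker D f c 1 g' h := by
    rintro h ⟨_, _, _, _, _, _, _, _, _, _, _, hm⟩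
    exact hm
  have hTfin : T.Finite := by
    obtain ⟨B, hB⟩ := M.exists_card_markers
    exact (hB 1 g').1.subset fun h hh => (hTm h hh).mono (by linarith)
  set A := ⌈ε * n⌉₊ + 1 with hA
  have hAr : ε * n ≤ A := by
    rw [hA]; push_cast; linarith [Nat.le_ceil (ε * n)]
  have hAr' : (A : ℝ) < ε * n + 2 := by
    rw [hA]; push_cast; linarith [Nat.ceil_lt_add_one (show 0 ≤ ε * n by positivity)]
  have hn₁' : 16 * B₀ ≤ ε' * n := by
    have : (n₁ : ℝ) ≤ n := by exact_mod_cast (le_max_left _ _).trans hn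
    rw [div_le_iff₀ hε'] at hn₁
    nlinarith
  have hn₂' : D 1 f + (c + 3 * d) + 1 + 2 * K + (c + d) + K * R ≤ ε * n := by
    have : (n₂ : ℝ) ≤ n := by exact_mod_cast (le_max_right _ _).trans hn
    rw [div_le_iff₀ hεpos] at hn₂
    nlinarith
  obtain ⟨h, hh, hgap⟩ := exists_gap_sequence (fun h => D 1 h) Q B₀ (4 * A) hTfin.toFinset
    (fun U t hU hUt => by
      obtain ⟨h1, h2⟩ := hB₁ 1 g' t Q
      rw [← Set.ncard_coe_finset]
      refine (Set.ncard_le_ncard ?_ h1).trans (h2.trans (Nat.le_succ _))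
      intro a ha
      exact ⟨(hTm a ((Set.Finite.mem_toFinset _).1 (hU ha))).mono (by linarith), hUt a ha⟩) (by
    rw [← Set.ncard_eq_toFinset_card _ hTfin]
    have h1 : ε * (8 * B₀) = ε' := by rw [hε]; field_simp
    have : ((4 * A * B₀ : ℕ) : ℝ) < T.ncard := by
      push_cast
      nlinarith
    exact_mod_cast this)
  have hhT : ∀ i ≤ 4 * A, h i ∈ T := fun i hi => (Set.Finite.mem_toFinset _).1 (hh i hi)
  have hch' : MarkerChain D f c Q (4 * A + 1) g' h :=
    ⟨fun i hi => hTm _ (hhT i (by omega)), fun i hi => hgap i (by omega)⟩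
  obtain ⟨g, i, s, t, hs, ht, hgn, hi, hno, hps, -, -⟩ := hhT (4 * A) le_rfl
  set p := M.word.pre g i with hp
  have hpN : D p (h (4 * A)) ≤ K := by
    have := M.dist_le_of_len_le (g := p) (h := h (4 * A)) (n := 1) (by
      rw [← hps, inv_mul_cancel_left, M.word.inv]; exact M.len_corr s hs)
    simpa using this
  have hψp : D 1 (h (4 * A)) - (c + d) - K ≤ gp D 1 p g' := by
    have h1 := (hch'.marker (4 * A) (by omega)).sub_le_gp M.hyp (by linarith)
    have h2 := M.hyp.gp_sub_le 1 (h (4 * A)) p g'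
    rw [M.hyp.symm] at h2
    linarith
  have hDp : D 1 (h (4 * A)) - (c + d) - K ≤ D 1 p := hψp.trans (M.hyp.gp_le_dist _ _ _)
  have hlt : ∀ j < 4 * A, D 1 (h j) + Q ≤ D 1 (h (4 * A)) := fun j hj =>
    hch'.add_le hQ0 hj (by omega)
  have hch : MarkerChain D f (c + d) Q (4 * A) p h := by
    refine ⟨fun j hj => ⟨(hch'.marker j (by omega)).1.trans (by linarith), ?_⟩,
      fun j hj => hch'.gap j (by omega)⟩
    refine (hch'.marker j (by omega)).right_of_lt M.hyp ?_
    linarith [hlt j hj]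
  obtain ⟨j₀, hj₀, hnm⟩ : ∃ j₀ < ⌈ε * n⌉₊, ¬ Marker D f (c + 2 * d) 1 g (h j₀) := by
    by_contra! hall
    exact hno ⟨h, hall, fun j hj => hch.gap j (by omega)⟩
  have hψg : gp D 1 g p < D 1 (h A) + (D 1 f + (c + 3 * d) + 1) := by
    have hm := hch.marker j₀ (by omega)
    have h1 : gp D (h j₀ * f) p g ≤ c + d + d := by
      refine (M.hyp.gp_right_or _ (h j₀) p g hm.2).resolve_left fun h2 => hnm ⟨?_, ?_⟩
      · linarith [hm.1]
      · linarith
    have h2 := M.hyp.gp_sub_le' 1 (h j₀ * f) p g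
    rw [M.hyp.gp_symm 1 g p]
    have h3 := Marker.dist_right_le M.hyp 1 (h j₀) f
    have h4 := hch.dist_mono hQ0 (i := j₀) (j := A) (by omega) (by omega)
    linarith
  have h2A := hlt (A + A) (by omega)
  obtain ⟨j, hj, τ, hτ, τ', hτ', -, hup, -, -, hlen⟩ := hR p (fun j => h (A + j)) (M.word.pre g)
    (fun t => 1 * M.word.pre g (len g - t)) A i (len g - i) (by omega)
    ((hch.mono (N' := 4 * A) le_rfl (by linarith)).shift A (by omega))
    (M.word.stepPath_pre g) (M.word.stepPath_reverse 1 g (len g))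
    (by
      have h1 := M.hyp.gp_le_dist 1 (M.word.pre g 0) p
      rw [M.dist_one_pre_zero] at h1
      have := M.hyp.nonneg 1 (h (A + 0))
      linarith)
    (by simpa using hψg)
    (by
      have : gp D 1 p p = D 1 p := by rw [gp, M.hyp.self]; ring
      rw [← hp, this]
      linarith)
    (by
      have : gp D 1 p p = D 1 p := by rw [gp, M.hyp.self]; ring
      rw [Nat.sub_sub_self hi, one_mul, ← hp, this]
      linarith)
    (by
      have h1 : i + (len g - i) = len g := by omega
      rw [h1]
      have h2 : (n : ℝ) ≤ (⌈1 / ε⌉₊ * A : ℕ) := by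
        push_cast
        calc (n : ℝ) = 1 / ε * (ε * n) := by field_simp
          _ ≤ ⌈1 / ε⌉₊ * A := by gcongr; exact Nat.le_ceil _
      exact hgn.trans (by exact_mod_cast h2))
  rw [one_mul, M.word.len_pre_inv_mul (by omega) (by omega)] at hlen
  have hnear : D (M.word.pre g τ) p ≤ K * R :=
    M.dist_le_of_len_le (by rw [hp, M.word.len_pre_inv_mul hτ hi]; omega)
  have h1 := M.hyp.gp_sub_le 1 p (M.word.pre g τ) p
  rw [M.hyp.symm p] at h1
  have h2 : gp D 1 p p = D 1 p := by rw [gp, M.hyp.self]; ring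
  have h3 := hch'.add_mul_le (i := A + j) (j := 4 * A - (A + j)) (by omega)
  have h4 : A + j + (4 * A - (A + j)) = 4 * A := by omega
  rw [h4] at h3
  have h5 : (A : ℝ) ≤ ((4 * A - (A + j) : ℕ) : ℝ) := by exact_mod_cast (by omega)
  have h6 : (A : ℝ) * 1 ≤ ((4 * A - (A + j) : ℕ) : ℝ) * Q := by
    gcongr
    linarith
  have hA0 : ε * n + 1 ≤ A := by
    rw [hA]; push_cast; linarith [Nat.le_ceil (ε * n)]
  linarith

/-- For all but a small proportion of the elements of a ball there is a chain of markers of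
length linear in the radius. -/
theorem exists_chain_density {Q : ℕ}
    (hQ : 2 * D 1 f + 2 * K + 20 * (c + 3 * d) + 2 ≤ (Q : ℝ)) {η : ℝ} (hη : 0 < η) :
    ∃ ε : ℝ, 0 < ε ∧ ∃ n₀ : ℕ, ∀ n ≥ n₀,
      ({g | len g ≤ n ∧ ¬ ∃ k : ℕ → G, MarkerChain D f (c + 2 * d) Q ⌈ε * n⌉₊ g k}.ncard : ℝ) ≤
        η * M.word.growth n := by
  classical
  have hg0 : (0 : ℝ) < M.word.growth (len f + 2) := by exact_mod_cast M.word.growth_pos _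
  obtain ⟨ε, hε, n₁, hn₁⟩ := M.exists_few_insertions hQ
    (ε' := η / (4 * (M.word.growth (len f + 2) * (S₁.card ^ 2 + 1)))) (by positivity)
  set ε' := η / (4 * (M.word.growth (len f + 2) * (S₁.card ^ 2 + 1))) with hε'
  obtain ⟨C, hC⟩ := exists_nat_ge (2 / η)
  obtain ⟨n₂, hn₂⟩ := M.eventually_growth_le (κ := 1 / 2) (by norm_num) 0 C
  refine ⟨ε, hε, max (max n₁ n₂) 1, fun n hn => ?_⟩
  have hn1 : 1 ≤ n := (le_max_right _ _).trans hn
  set E := (M.word.fball n).filter fun g =>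
    n / 2 < len g ∧ ¬ ∃ k : ℕ → G, MarkerChain D f (c + 2 * d) Q ⌈ε * n⌉₊ g k with hE
  have hsmall : (M.word.growth (n / 2) : ℝ) ≤ η / 2 * M.word.growth n := by
    have h1 := hn₂ n ((le_max_right _ _).trans ((le_max_left _ _).trans hn)) (n / 2) (by
      have := @Nat.cast_div_le ℝ _ _ _ n 2
      push_cast at this
      linarith)
    have h2 : (C : ℝ) * (n + 1) * M.word.growth (n / 2) ≤ M.word.growth n := by exact_mod_cast h1
    have h3 : (0 : ℝ) ≤ M.word.growth (n / 2) := Nat.cast_nonneg _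
    have h4 : 2 / η * 1 * (M.word.growth (n / 2) : ℝ) ≤
        C * (n + 1) * M.word.growth (n / 2) := by
      gcongr
      have : (0 : ℝ) ≤ n := Nat.cast_nonneg _
      linarith
    have h5 : (M.word.growth (n / 2) : ℝ) = η / 2 * (2 / η * 1 * M.word.growth (n / 2)) := by
      field_simp
    rw [h5]
    gcongr
    linarith
  have hpairs : E.card * (n / 2 + 1) ≤
      M.word.growth (n + (len f + 2)) * ⌊ε' * n⌋₊ * S₁.card ^ 2 := by
    have hinj : Set.InjOn (fun x : G × ℕ => (M.word.pre x.1 x.2, (M.word.pre x.1 x.2)⁻¹ * x.1))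
        (E ×ˢ Finset.range (n / 2 + 1) : Finset (G × ℕ)) := by
      rintro ⟨g, i⟩ hx ⟨g', i'⟩ hx' heq
      simp only [Finset.coe_product, Set.mem_prod, Finset.mem_coe, Finset.mem_range, hE,
        Finset.mem_filter] at hx hx'
      simp only [Prod.mk.injEq] at heq
      obtain ⟨h1, h2⟩ := heq
      have h3 : i = i' := by
        rw [← M.word.len_pre (g := g) (t := i) (by omega), h1, M.word.len_pre (by omega)]
      rw [h1] at h2
      exact Prod.ext (mul_left_cancel h2) h3
    rw [← Finset.card_range (n / 2 + 1), ← Finset.card_product, ← Finset.card_image_of_injOn hinj]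
    refine M.card_pairs_le _ _ _ ?_ ?_
    · intro a ha
      rw [Finset.mem_image] at ha
      obtain ⟨⟨g, i⟩, hx, rfl⟩ := ha
      simp only [Finset.mem_product, Finset.mem_range, hE, Finset.mem_filter,
        WordNorm.mem_fball] at hx
      simp only
      rw [M.word.len_pre (by omega), M.word.len_pre_inv_mul_self (by omega)]
      omega
    · intro g'
      refine Nat.le_floor (le_trans ?_ (hn₁ n ((le_max_left _ _).trans
        ((le_max_left _ _).trans hn)) g'))
      refine Nat.cast_le.2 (Set.ncard_le_ncard ?_ ?_)
      · rintro h ⟨a, ha, s, hs, t, ht, h1, h2, h3⟩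
        rw [Finset.mem_image] at ha
        obtain ⟨⟨g, i⟩, hx, rfl⟩ := ha
        simp only [Finset.mem_product, Finset.mem_range, hE, Finset.mem_filter,
          WordNorm.mem_fball] at hx
        exact ⟨g, i, s, t, hs, ht, hx.1.1, by omega, hx.1.2.2, h1, h2, h3⟩
      · obtain ⟨B, hB⟩ := M.exists_card_markers
        refine (hB 1 g').1.subset ?_
        rintro h ⟨_, _, _, _, _, _, _, _, _, _, _, hm⟩
        exact hm.mono (by linarith [M.d_pos])
  have hEcard : (E.card : ℝ) ≤ η / 2 * M.word.growth n := by
    have h1 : ((E.card * (n / 2 + 1) : ℕ) : ℝ) ≤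
        ((M.word.growth (n + (len f + 2)) * ⌊ε' * n⌋₊ * S₁.card ^ 2 : ℕ) : ℝ) := by
      exact_mod_cast hpairs
    have h2 : (n : ℝ) / 2 ≤ (n / 2 + 1 : ℕ) := by
      have : n ≤ 2 * (n / 2 + 1) := by omega
      have : (n : ℝ) ≤ 2 * (n / 2 + 1 : ℕ) := by exact_mod_cast this
      linarith
    have h3 : (M.word.growth (n + (len f + 2)) : ℝ) ≤
        M.word.growth n * M.word.growth (len f + 2) := by
      exact_mod_cast M.word.growth_add_le _ _
    have h4 : (⌊ε' * n⌋₊ : ℝ) ≤ ε' * n := Nat.floor_le (by positivity)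
    have h5 : (E.card : ℝ) * (n / 2) ≤
        M.word.growth n * M.word.growth (len f + 2) * (ε' * n) * (S₁.card ^ 2 + 1) := by
      calc (E.card : ℝ) * (n / 2) ≤ E.card * (n / 2 + 1 : ℕ) := by gcongr
        _ = (E.card * (n / 2 + 1) : ℕ) := by rw [Nat.cast_mul]
        _ ≤ _ := h1
        _ = (M.word.growth (n + (len f + 2)) : ℝ) * ⌊ε' * n⌋₊ * S₁.card ^ 2 := by push_cast; ring
        _ ≤ _ := by gcongr; linarith
    have h6 : (M.word.growth n : ℝ) * M.word.growth (len f + 2) * (ε' * n) * (S₁.card ^ 2 + 1) =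
        η / 2 * M.word.growth n * (n / 2) := by
      rw [hε']; field_simp; ring
    rw [h6] at h5
    have hn0 : (0 : ℝ) < n / 2 := by
      have : (1 : ℝ) ≤ n := by exact_mod_cast hn1
      linarith
    exact le_of_mul_le_mul_right h5 hn0
  have hsub : {g | len g ≤ n ∧ ¬ ∃ k : ℕ → G, MarkerChain D f (c + 2 * d) Q ⌈ε * n⌉₊ g k} ⊆
      ((E ∪ M.word.fball (n / 2) : Finset G) : Set G) := by
    rintro g ⟨h1, h2⟩
    rw [Finset.mem_coe, Finset.mem_union, hE, Finset.mem_filter, WordNorm.mem_fball,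
      WordNorm.mem_fball]
    rcases lt_or_ge (n / 2) (len g) with h | h
    · exact Or.inl ⟨h1, h, h2⟩
    · exact Or.inr h
  have h1 := Set.ncard_le_ncard hsub (Finset.finite_toSet _)
  rw [Set.ncard_coe_finset] at h1
  have h2 := h1.trans (Finset.card_union_le _ _)
  have h3 : ({g | len g ≤ n ∧ ¬ ∃ k : ℕ → G,
      MarkerChain D f (c + 2 * d) Q ⌈ε * n⌉₊ g k}.ncard : ℝ) ≤ E.card + M.word.growth (n / 2) := by
    exact_mod_cast h2
  linarith

end MarkerSystem

/-! ### Markers that also see the inverse and the square -/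

theorem WordNorm.ncard_prefix_relation_le {len : G → ℕ} (W : WordNorm len) (n m R : ℕ) :
    {g | len g ≤ n ∧ ∃ a b, a + m ≤ len g ∧ b + m ≤ len g ∧
      len ((W.pre g a)⁻¹ * g * W.pre g b) ≤ R}.ncard ≤
      2 * (n + 1) * W.growth (n - m) * W.growth R := by
  classical
  set P := W.fball (n - m) ×ˢ Finset.range (n + 1) ×ˢ W.fball R with hP
  have hcard : P.card = W.growth (n - m) * ((n + 1) * W.growth R) := by
    rw [hP, Finset.card_product, Finset.card_product, Finset.card_range]; rfl
  have hsub : {g | len g ≤ n ∧ ∃ a b, a + m ≤ len g ∧ b + m ≤ len g ∧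
      len ((W.pre g a)⁻¹ * g * W.pre g b) ≤ R} ⊆
      ((P.image fun x => x.1 * x.2.2 * (W.pre x.1 x.2.1)⁻¹) ∪
        P.image fun x => W.pre x.1 x.2.1 * x.2.2 * x.1⁻¹ : Finset G) := by
    rintro g ⟨hg, a, b, ha, hb, hr⟩
    rw [Finset.mem_coe, Finset.mem_union, Finset.mem_image, Finset.mem_image]
    rcases le_total b a with h | h
    · left
      refine ⟨(W.pre g a, b, (W.pre g a)⁻¹ * g * W.pre g b), ?_, ?_⟩
      · simp only [hP, Finset.mem_product, Finset.mem_range, mem_fball]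
        exact ⟨by rw [W.len_pre (by omega)]; omega, by omega, hr⟩
      · simp only [W.pre_pre h (by omega : a ≤ len g)]
        group
    · right
      refine ⟨(W.pre g b, a, (W.pre g a)⁻¹ * g * W.pre g b), ?_, ?_⟩
      · simp only [hP, Finset.mem_product, Finset.mem_range, mem_fball]
        exact ⟨by rw [W.len_pre (by omega)]; omega, by omega, hr⟩
      · simp only [W.pre_pre h (by omega : b ≤ len g)]
        group
  have h1 := Set.ncard_le_ncard hsub (Finset.finite_toSet _)
  rw [Set.ncard_coe_finset] at h1
  refine h1.trans ((Finset.card_union_le _ _).trans ?_)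
  have h2 := Finset.card_image_le (s := P) (f := fun x => x.1 * x.2.2 * (W.pre x.1 x.2.1)⁻¹)
  have h3 := Finset.card_image_le (s := P) (f := fun x => W.pre x.1 x.2.1 * x.2.2 * x.1⁻¹)
  have h4 : 2 * (n + 1) * W.growth (n - m) * W.growth R = P.card + P.card := by
    rw [hcard]; ring
  omega

namespace MarkerSystem

variable {len : G → ℕ} {D : G → G → ℝ} {d c K : ℝ} {f : G} {S₁ : Finset G}
  (M : MarkerSystem len D d c K f S₁)
include M

theorem gp_self_right (g : G) : gp D 1 g g = D 1 g := by
  rw [gp, M.hyp.self]; ring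

theorem dist_mul_pre_zero (k g : G) : D k (k * M.word.pre g 0) = 0 := by
  have := M.hyp.inv k 1 (M.word.pre g 0)
  rwa [mul_one, M.dist_one_pre_zero] at this

theorem le_of_mul_le_dist {Q : ℝ} (hQ : K ≤ Q) {x y : G} {m k : ℕ} (h : m * Q ≤ D x y)
    (hk : len (x⁻¹ * y) ≤ k) : m ≤ k := by
  have h1 := M.dist_le_of_len_le hk
  have h2 := M.K_pos
  have h3 : (m : ℝ) * K ≤ m * Q := by gcongr
  have h4 : (m : ℝ) * K ≤ k * K := by linarith
  exact_mod_cast le_of_mul_le_mul_right h4 h2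

theorem exists_prefix_relation_of_inv {Q : ℝ}
    (hQ : 2 * D 1 f + 2 * K + 20 * (c + 3 * d) + 2 ≤ Q) (Λ : ℕ) :
    ∃ R : ℕ, ∀ (g : G) (m : ℕ) (h : ℕ → G), 0 < m → MarkerChain D f (c + 2 * d) Q (8 * m) g h →
      2 * len g ≤ Λ * m → ¬ gp D (h (3 * m)) g⁻¹ (h (3 * m) * f) ≤ c + 3 * d →
      ∃ a b, a + m ≤ len g ∧ b + m ≤ len g ∧
        len ((M.word.pre g a)⁻¹ * g * M.word.pre g b) ≤ R := by
  obtain ⟨R, hR⟩ := M.exists_close hQ Λ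
  refine ⟨R, fun g m h hm hc hΛ hfail => ?_⟩
  have hf := M.long
  have hcp := M.c_pos
  have hdp := M.d_pos
  have hKp := M.K_pos
  have hQ0 : 0 ≤ Q := by linarith
  set k := 3 * m with hk
  have hmk := hc.marker k (by omega)
  have h1 : gp D (h k) 1 g⁻¹ ≤ c + 3 * d := by
    have h2 : gp D (h k) (h k * f) 1 ≤ c + 2 * d := by rw [M.hyp.gp_symm]; exact hmk.1
    rcases M.hyp.gp_right_or (h k) (h k * f) 1 g⁻¹ h2 with h3 | h3
    · rw [M.hyp.gp_symm] at h3
      exact absurd (by linarith) hfail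
    · linarith
  have hψinv : D 1 (h k) - (c + 4 * d) ≤ gp D 1 g⁻¹ g := by
    have h2 := M.hyp.min_gp_le 1 g⁻¹ (h k) g
    have h3 := hmk.sub_le_gp M.hyp (by linarith)
    have h4 := M.hyp.gp_add 1 (h k) g⁻¹
    rw [M.hyp.gp_symm 1 (h k)] at h4
    rcases min_le_iff.1 h2 with h5 | h5 <;> linarith
  have hψg : D 1 (h k) - 2 * (c + 3 * d) ≤ D 1 g := by
    have := hmk.dist_le M.hyp (by linarith)
    linarith
  have hlt := hc.add_le hQ0 (i := m + m) (j := k) (by omega) (by omega)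
  have hend : gp D 1 g⁻¹ g ≤ gp D 1 (g⁻¹ * M.word.pre g 0) g := by
    have := M.hyp.gp_sub_le 1 g⁻¹ (g⁻¹ * M.word.pre g 0) g
    rw [M.dist_mul_pre_zero] at this
    linarith
  obtain ⟨j, hj, t, ht, t', ht', -, hup, hlo', hup', hlen⟩ := hR g (fun j => h (m + j))
    (M.word.pre g) (fun t => g⁻¹ * M.word.pre g (len g - t)) m (len g) (len g) hm
    (hc.shift m (by omega)) (M.word.stepPath_pre g) (M.word.stepPath_reverse g⁻¹ g (len g))
    (by
      have h1 := M.hyp.gp_le_dist 1 (M.word.pre g 0) g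
      rw [M.dist_one_pre_zero] at h1
      have := M.hyp.nonneg 1 (h (m + 0))
      linarith)
    (by
      have h1 := M.hyp.gp_le_dist 1 1 g
      rw [M.hyp.self] at h1
      have := M.hyp.nonneg 1 (h (m + 0))
      simp only [Nat.sub_zero, M.word.pre_len, inv_mul_cancel]
      linarith)
    (by
      rw [M.word.pre_len, M.gp_self_right]
      linarith)
    (by
      rw [Nat.sub_self]
      linarith)
    (by omega)
  have hjk := hc.add_mul_le (i := m + j) (j := m + 1) (by omega)
  have hjk' := hc.dist_mono hQ0 (i := m + j + (m + 1)) (j := k) (by omega) (by omega)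
  push_cast at hjk
  refine ⟨len g - t', t, ?_, ?_, ?_⟩
  · have h2 : m ≤ t' := by
      refine M.le_of_mul_le_dist (Q := Q) (by linarith) (x := 1)
        (y := g⁻¹ * M.word.pre g (len g - t')) ?_ ?_
      · have h3 := M.hyp.gp_le_dist 1 (g⁻¹ * M.word.pre g (len g - t')) g
        have h4 := hc.add_mul_le (i := 0) (j := m) (by omega)
        rw [zero_add] at h4
        have h5 := hc.dist_mono hQ0 (i := m) (j := m + j) (by omega) (by omega)
        have := M.hyp.nonneg 1 (h 0)
        linarith
      · rw [inv_one, one_mul, M.word.len_comm, M.word.len_pre_inv_mul_self (by omega)]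
        omega
    omega
  · have h2 : m ≤ len g - t := by
      refine M.le_of_mul_le_dist (Q := Q) (by linarith) (x := M.word.pre g t) (y := g) ?_
        (M.word.len_pre_inv_mul_self ht).le
      have h3 := M.hyp.gp_sub_le 1 g (M.word.pre g t) g
      rw [M.gp_self_right, M.hyp.symm g] at h3
      linarith
    omega
  · rw [← M.word.inv]
    simpa [mul_assoc] using hlen

theorem exists_prefix_relation_of_sq {Q : ℝ}
    (hQ : 2 * D 1 f + 2 * K + 20 * (c + 3 * d) + 2 ≤ Q) (Λ : ℕ) :
    ∃ R : ℕ, ∀ (g : G) (m : ℕ) (h : ℕ → G), 0 < m → MarkerChain D f (c + 2 * d) Q (8 * m) g h →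
      2 * len g ≤ Λ * m →
      ¬ gp D (h (3 * m + (m - 1)) * f) (h (3 * m + (m - 1))) (g ^ 2) ≤ c + 3 * d →
      ∃ a b, a + m ≤ len g ∧ b + m ≤ len g ∧
        len ((M.word.pre g a)⁻¹ * g * M.word.pre g b) ≤ R := by
  obtain ⟨R, hR⟩ := M.exists_close hQ Λ
  refine ⟨R, fun g m h hm hc hΛ hfail => ?_⟩
  have hf := M.long
  have hcp := M.c_pos
  have hdp := M.d_pos
  have hKp := M.K_pos
  have hQ0 : 0 ≤ Q := by linarith
  set e := 3 * m + (m - 1) with he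
  have hme := hc.marker e (by omega)
  have h1 : gp D (h e * f) g (g ^ 2) ≤ c + 3 * d := by
    rcases M.hyp.gp_right_or (h e * f) (h e) g (g ^ 2) hme.2 with h3 | h3
    · exact absurd (by linarith) hfail
    · linarith
  have hψsq : gp D 1 (g ^ 2) g ≤ D 1 (h e) + D 1 f + (c + 3 * d) := by
    have h2 := M.hyp.gp_sub_le' 1 (h e * f) (g ^ 2) g
    rw [M.hyp.gp_symm (h e * f)] at h2
    have h3 := Marker.dist_right_le M.hyp 1 (h e) f
    linarith
  have hψg : D 1 (h (8 * m - 1)) - 2 * (c + 3 * d) ≤ D 1 g := by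
    have := (hc.marker (8 * m - 1) (by omega)).dist_le M.hyp (by linarith)
    linarith
  have hlt := hc.add_le hQ0 (i := 5 * m + m) (j := 8 * m - 1) (by omega) (by omega)
  have hlt' := hc.add_le hQ0 (i := e) (j := 5 * m + 0) (by omega) (by omega)
  have hend : gp D 1 g g ≤ gp D 1 (g * M.word.pre g 0) g := by
    have := M.hyp.gp_sub_le 1 g (g * M.word.pre g 0) g
    rw [M.dist_mul_pre_zero] at this
    linarith
  rw [M.gp_self_right] at hend
  obtain ⟨j, hj, t, ht, t', ht', -, hup, hlo', -, hlen⟩ := hR g (fun j => h (5 * m + j))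
    (M.word.pre g) (fun t => g * M.word.pre g (len g - t)) m (len g) (len g) hm
    (hc.shift (5 * m) (by omega)) (M.word.stepPath_pre g) (M.word.stepPath_reverse g g (len g))
    (by
      have h1 := M.hyp.gp_le_dist 1 (M.word.pre g 0) g
      rw [M.dist_one_pre_zero] at h1
      have := M.hyp.nonneg 1 (h (5 * m + 0))
      linarith)
    (by
      simp only [Nat.sub_zero, M.word.pre_len, ← sq]
      linarith)
    (by
      rw [M.word.pre_len, M.gp_self_right]
      linarith)
    (by
      rw [Nat.sub_self]
      linarith)
    (by omega)
  refine ⟨t, len g - t', ?_, ?_, by simpa [mul_assoc] using hlen⟩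
  · have h2 : m ≤ len g - t := by
      refine M.le_of_mul_le_dist (Q := Q) (by linarith) (x := M.word.pre g t) (y := g) ?_
        (M.word.len_pre_inv_mul_self ht).le
      have h3 := M.hyp.gp_sub_le 1 g (M.word.pre g t) g
      rw [M.gp_self_right, M.hyp.symm g] at h3
      have h4 := hc.add_mul_le (i := 5 * m + j) (j := m + 1) (by omega)
      have h5 := hc.dist_mono hQ0 (i := 5 * m + j + (m + 1)) (j := 8 * m - 1) (by omega) (by omega)
      push_cast at h4
      linarith
    omega
  · have h2 : m ≤ t' := by
      refine M.le_of_mul_le_dist (Q := Q) (by linarith) (x := g ^ 2)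
        (y := g * M.word.pre g (len g - t')) ?_ ?_
      · have h3 := M.hyp.gp_sub_le 1 (g * M.word.pre g (len g - t')) (g ^ 2) g
        rw [M.hyp.symm] at h3
        have h4 := hc.add_mul_le (i := e) (j := m + 1) (by omega)
        have h5 := hc.dist_mono hQ0 (i := e + (m + 1)) (j := 5 * m + j) (by omega) (by omega)
        push_cast at h4
        linarith
      · rw [M.word.len_comm, sq, mul_inv_rev, mul_assoc, inv_mul_cancel_left,
          M.word.len_pre_inv_mul_self (by omega)]
        omega
    omega

/-- For all but a small proportion of the elements `g` of a ball there is a chain of markers of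
length linear in the radius, which are also seen from `g⁻¹` and `g ^ 2`. -/
theorem exists_good_chain_density {Q : ℕ}
    (hQ : 2 * D 1 f + 2 * K + 20 * (c + 3 * d) + 2 ≤ (Q : ℝ)) {η : ℝ} (hη : 0 < η) :
    ∃ ε : ℝ, 0 < ε ∧ ∃ n₀ : ℕ, ∀ n ≥ n₀,
      ({g | len g ≤ n ∧ ¬ ∃ h : ℕ → G, MarkerChain D f (c + 2 * d) Q ⌈ε * n⌉₊ g h ∧
        gp D (h 0) g⁻¹ (h 0 * f) ≤ c + 3 * d ∧
        gp D (h (⌈ε * n⌉₊ - 1) * f) (h (⌈ε * n⌉₊ - 1)) (g ^ 2) ≤ c + 3 * d}.ncard : ℝ) ≤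
        η * M.word.growth n := by
  obtain ⟨ε₁, hε₁, n₁, hn₁⟩ := M.exists_chain_density hQ (half_pos hη)
  set ε := min ε₁ 1 / 16 with hε
  have hεpos : 0 < ε := by positivity
  have hεle : 16 * ε ≤ ε₁ := by rw [hε]; linarith [min_le_left ε₁ 1]
  have hεle' : ε ≤ 1 := by rw [hε]; linarith [min_le_right ε₁ 1]
  obtain ⟨R₁, hR₁⟩ := M.exists_prefix_relation_of_inv hQ ⌈2 / ε⌉₊
  obtain ⟨R₂, hR₂⟩ := M.exists_prefix_relation_of_sq hQ ⌈2 / ε⌉₊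
  obtain ⟨C, hC⟩ := exists_nat_ge (4 * M.word.growth (max R₁ R₂) / η)
  obtain ⟨n₂, hn₂⟩ := M.eventually_growth_le hεpos 0 C
  obtain ⟨n₃, hn₃⟩ := exists_nat_ge (16 / ε₁)
  refine ⟨ε, hεpos, max (max n₁ n₂) (max n₃ 1), fun n hn => ?_⟩
  have hnn₁ : n₁ ≤ n := (le_max_left _ _).trans ((le_max_left _ _).trans hn)
  have hnn₂ : n₂ ≤ n := (le_max_right _ _).trans ((le_max_left _ _).trans hn)
  have hnn₃ : n₃ ≤ n := (le_max_left _ _).trans ((le_max_right _ _).trans hn)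
  have hn1 : 1 ≤ n := (le_max_right _ _).trans ((le_max_right _ _).trans hn)
  have hn0 : (0 : ℝ) < n := by exact_mod_cast hn1
  set m := ⌈ε * n⌉₊ with hm
  have hmpos : 0 < m := Nat.ceil_pos.2 (by positivity)
  have hmge : ε * n ≤ m := Nat.le_ceil _
  have h8 : 8 * m ≤ ⌈ε₁ * n⌉₊ := by
    have h1 : (m : ℝ) < ε * n + 1 := Nat.ceil_lt_add_one (by positivity)
    have h2 : 16 ≤ ε₁ * n := by
      have : (n₃ : ℝ) ≤ n := by exact_mod_cast hnn₃
      rw [div_le_iff₀ hε₁] at hn₃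
      nlinarith
    have h3 : 16 * ε * n ≤ ε₁ * n := by gcongr
    have h4 : ((8 * m : ℕ) : ℝ) ≤ ⌈ε₁ * n⌉₊ := by
      push_cast
      linarith [Nat.le_ceil (ε₁ * n)]
    exact_mod_cast h4
  have hΛ : 2 * n ≤ ⌈2 / ε⌉₊ * m := by
    have : ((2 * n : ℕ) : ℝ) ≤ (⌈2 / ε⌉₊ * m : ℕ) := by
      push_cast
      calc (2 * n : ℝ) = 2 / ε * (ε * n) := by field_simp
        _ ≤ ⌈2 / ε⌉₊ * m := by gcongr; exact Nat.le_ceil _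
    exact_mod_cast this
  set E := {g | len g ≤ n ∧ ∃ a b, a + m ≤ len g ∧ b + m ≤ len g ∧
      len ((M.word.pre g a)⁻¹ * g * M.word.pre g b) ≤ max R₁ R₂} with hE
  have hEcard := M.word.ncard_prefix_relation_le n m (max R₁ R₂)
  rw [← hE] at hEcard
  have hEle : (E.ncard : ℝ) ≤ η / 2 * M.word.growth n := by
    have h1 := hn₂ n hnn₂ (n - m) (by
      rcases le_total m n with h | h
      · rw [Nat.cast_sub h]
        linarith
      · rw [Nat.sub_eq_zero_of_le h, Nat.cast_zero]
        have : 0 ≤ (1 - ε) * n := mul_nonneg (by linarith) hn0.le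
        linarith)
    have h2 : (C : ℝ) * (n + 1) * M.word.growth (n - m) ≤ M.word.growth n := by exact_mod_cast h1
    have h3 : (E.ncard : ℝ) ≤ 2 * (n + 1) * M.word.growth (n - m) * M.word.growth (max R₁ R₂) := by
      exact_mod_cast hEcard
    calc (E.ncard : ℝ) ≤ 2 * (n + 1) * M.word.growth (n - m) * M.word.growth (max R₁ R₂) := h3
      _ = η / 2 * (4 * M.word.growth (max R₁ R₂) / η * (n + 1) * M.word.growth (n - m)) := by
        field_simp; ring
      _ ≤ η / 2 * (C * (n + 1) * M.word.growth (n - m)) := by gcongr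
      _ ≤ _ := by gcongr
  have hsub : {g | len g ≤ n ∧ ¬ ∃ h : ℕ → G, MarkerChain D f (c + 2 * d) Q m g h ∧
      gp D (h 0) g⁻¹ (h 0 * f) ≤ c + 3 * d ∧
      gp D (h (m - 1) * f) (h (m - 1)) (g ^ 2) ≤ c + 3 * d} ⊆
      {g | len g ≤ n ∧ ¬ ∃ k : ℕ → G, MarkerChain D f (c + 2 * d) Q ⌈ε₁ * n⌉₊ g k} ∪ E := by
    rintro g ⟨hg, hno⟩
    by_cases hk : ∃ k : ℕ → G, MarkerChain D f (c + 2 * d) Q ⌈ε₁ * n⌉₊ g k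
    · right
      obtain ⟨k, hk⟩ := hk
      have hk8 := hk.mono h8 le_rfl
      have hlen : 2 * len g ≤ ⌈2 / ε⌉₊ * m := le_trans (by omega) hΛ
      refine ⟨hg, ?_⟩
      by_cases hinv : gp D (k (3 * m)) g⁻¹ (k (3 * m) * f) ≤ c + 3 * d
      · by_cases hsq :
          gp D (k (3 * m + (m - 1)) * f) (k (3 * m + (m - 1))) (g ^ 2) ≤ c + 3 * d
        · exact absurd ⟨fun i => k (3 * m + i), hk8.shift (3 * m) (by omega), hinv, hsq⟩ hno
        · obtain ⟨a, b, ha, hb, hr⟩ := hR₂ g m k hmpos hk8 hlen hsq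
          exact ⟨a, b, ha, hb, hr.trans (le_max_right _ _)⟩
      · obtain ⟨a, b, ha, hb, hr⟩ := hR₁ g m k hmpos hk8 hlen hinv
        exact ⟨a, b, ha, hb, hr.trans (le_max_left _ _)⟩
    · exact Or.inl ⟨hg, hk⟩
  have hfin := M.word.finite n
  have h1 := Set.ncard_le_ncard hsub
    ((hfin.subset fun g hg => hg.1).union (hfin.subset fun g hg => hg.1))
  have h2 := h1.trans (Set.ncard_union_le _ _)
  have h3 := hn₁ n hnn₁
  have h4 : ({g | len g ≤ n ∧ ¬ ∃ h : ℕ → G, MarkerChain D f (c + 2 * d) Q m g h ∧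
      gp D (h 0) g⁻¹ (h 0 * f) ≤ c + 3 * d ∧
      gp D (h (m - 1) * f) (h (m - 1)) (g ^ 2) ≤ c + 3 * d}.ncard : ℝ) ≤
      ({g | len g ≤ n ∧ ¬ ∃ k : ℕ → G,
        MarkerChain D f (c + 2 * d) Q ⌈ε₁ * n⌉₊ g k}.ncard : ℝ) + E.ncard := by
    exact_mod_cast h2
  linarith

end MarkerSystem

/-! ### Powers of a loxodromic element -/

namespace InvHyp

variable {D : G → G → ℝ} {d : ℝ} (H : InvHyp D d)
include H

theorem dist_pow_pow (φ : G) (i j : ℕ) : D (φ ^ i) (φ ^ (i + j)) = D 1 (φ ^ j) := by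
  rw [pow_add, ← H.inv (φ ^ i) 1 (φ ^ j), mul_one]

theorem dist_pow_add_le (φ : G) (i j : ℕ) :
    D 1 (φ ^ (i + j)) ≤ D 1 (φ ^ i) + D 1 (φ ^ j) := by
  have := H.tri 1 (φ ^ i) (φ ^ (i + j))
  rwa [H.dist_pow_pow] at this

theorem dist_pow_le_add (φ : G) (i j : ℕ) :
    D 1 (φ ^ i) ≤ D 1 (φ ^ (i + j)) + D 1 (φ ^ j) := by
  have := H.tri 1 (φ ^ (i + j)) (φ ^ i)
  rwa [H.symm (φ ^ (i + j)), H.dist_pow_pow] at this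

theorem dist_pow_le_mul (φ : G) (n : ℕ) : D 1 (φ ^ n) ≤ n * D 1 φ := by
  induction n with
  | zero => simp [H.self]
  | succ n ih =>
    have := H.dist_pow_add_le φ n 1
    rw [pow_one] at this
    push_cast
    linarith

theorem add_dist_pow_le {ψ : G} (hψ : D 1 ψ + 4 * d < D 1 (ψ ^ 2)) (k j : ℕ) :
    D 1 (ψ ^ k) + D 1 (ψ ^ j) ≤ D 1 (ψ ^ (k + j)) + 2 * D 1 ψ + 4 * d := by
  have hd := H.d_nonneg
  have h0 : D 1 (ψ ^ 0) = 0 := by rw [pow_zero, H.self]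
  have h1 : D 1 (ψ ^ 1) = D 1 ψ := by rw [pow_one]
  have hstep : ∀ k, D 1 (ψ ^ k) + (D 1 (ψ ^ 2) - D 1 ψ - 2 * d) ≤ D 1 (ψ ^ (k + 1)) := by
    intro k
    induction k with
    | zero =>
      have := H.dist_pow_add_le ψ 1 1
      norm_num at this ⊢
      rw [H.self]
      linarith
    | succ k ih =>
      have h4 := H.four 1 (ψ ^ (k + 1)) (ψ ^ k) (ψ ^ (k + 2))
      have e1 := H.dist_pow_pow ψ (k + 1) 1
      have e2 := H.dist_pow_pow ψ k 1
      rw [H.dist_pow_pow ψ k 2, show k + 2 = k + 1 + 1 from rfl, e1, H.symm (ψ ^ (k + 1)), e2,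
        h1] at h4
      rcases le_max_iff.1 (sub_le_iff_le_add.2 h4) with h5 | h5 <;> linarith
  rcases j with _ | j
  · have := H.nonneg 1 ψ
    rw [h0, Nat.add_zero]
    linarith
  · have h4 := H.four 1 (ψ ^ (k + 1)) (ψ ^ k) (ψ ^ (k + (j + 1)))
    have e1 := H.dist_pow_pow ψ (k + 1) j
    have e2 := H.dist_pow_pow ψ k 1
    rw [H.dist_pow_pow ψ k (j + 1), show k + (j + 1) = k + 1 + j by ring, e1,
      H.symm (ψ ^ (k + 1)), e2, h1] at h4
    have h5 := hstep k
    have h6 := hstep j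
    have h8 := H.nonneg 1 ψ
    rw [show k + (j + 1) = k + 1 + j by ring]
    rcases le_max_iff.1 (sub_le_iff_le_add.2 h4) with h7 | h7 <;> linarith

theorem exists_gp_pow_le {φ : G} {τ : ℝ} (hτ : 0 < τ)
    (hlim : Filter.Tendsto (fun n : ℕ => D 1 (φ ^ n) / n) Filter.atTop (nhds τ)) :
    ∃ C, ∀ N M : ℕ, gp D (φ ^ N) 1 (φ ^ (N + M)) ≤ C := by
  obtain ⟨n, hn, hn0⟩ : ∃ n : ℕ, D 1 (φ ^ n) + 4 * d < D 1 (φ ^ (2 * n)) ∧ 0 < n := by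
    have h2 : Filter.Tendsto (fun n : ℕ => D 1 (φ ^ (2 * n)) / ((2 * n : ℕ) : ℝ))
        Filter.atTop (nhds τ) :=
      hlim.comp (Filter.tendsto_id.const_mul_atTop' (by norm_num : 0 < 2))
    have h3 := (h2.const_mul 2).sub hlim
    have h4 := h3.eventually (lt_mem_nhds (show τ / 2 < 2 * τ - τ by linarith))
    obtain ⟨n₀, hn₀⟩ := exists_nat_gt (4 * d / (τ / 2))
    obtain ⟨n, h5, h6, h7⟩ :=
      (h4.and ((Filter.eventually_ge_atTop n₀).and (Filter.eventually_gt_atTop 0))).exists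
    refine ⟨n, ?_, h7⟩
    have hnpos : (0 : ℝ) < n := by exact_mod_cast h7
    have h8 : (n₀ : ℝ) ≤ n := by exact_mod_cast h6
    have h9 : 4 * d < n * (τ / 2) := by
      rw [div_lt_iff₀ (by linarith)] at hn₀
      exact hn₀.trans_le (mul_le_mul_of_nonneg_right h8 (by linarith))
    have h10 : 2 * (D 1 (φ ^ (2 * n)) / ((2 * n : ℕ) : ℝ)) - D 1 (φ ^ n) / n =
        (D 1 (φ ^ (2 * n)) - D 1 (φ ^ n)) / n := by
      push_cast
      field_simp
    rw [h10, lt_div_iff₀ hnpos] at h5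
    linarith
  refine ⟨D 1 (φ ^ n) + 2 * d + 2 * (n * D 1 φ), fun N M => ?_⟩
  have hD := H.nonneg 1 φ
  have hr : ∀ r, D 1 (φ ^ (r % n)) ≤ n * D 1 φ := fun r =>
    (H.dist_pow_le_mul φ _).trans (mul_le_mul_of_nonneg_right
      (by exact_mod_cast (Nat.mod_lt r hn0).le) hD)
  have hψ : D 1 (φ ^ n) + 4 * d < D 1 ((φ ^ n) ^ 2) := by rwa [← pow_mul, mul_comm n 2]
  have h1 := H.add_dist_pow_le hψ (N / n) (M / n)
  simp only [← pow_mul] at h1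
  have h2 := H.dist_pow_add_le φ (n * (N / n)) (N % n)
  have h3 := H.dist_pow_add_le φ (n * (M / n)) (M % n)
  have h4 := H.dist_pow_le_add φ (n * (N / n + M / n)) (N % n + M % n)
  have h5 := H.dist_pow_add_le φ (N % n) (M % n)
  have h6 : n * (N / n + M / n) + (N % n + M % n) = N + M := by
    have := Nat.div_add_mod N n
    have := Nat.div_add_mod M n
    rw [mul_add]
    omega
  rw [h6] at h4
  rw [Nat.div_add_mod] at h2 h3
  have h7 := hr N
  have h8 := hr M
  unfold gp
  rw [H.symm (φ ^ N) 1, H.dist_pow_pow]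
  linarith

theorem displacement_le {x y u h : G} {C κ : ℝ} (hu : gp D u x y ≤ C) (hx : D x (h * x) ≤ κ)
    (hy : D y (h * y) ≤ κ) : D u (h * u) ≤ 2 * C + 6 * κ + 2 * d := by
  have h1 : gp D (h * u) x y ≤ C + 2 * κ := by
    have h2 := H.tri (h * u) (h * x) x
    have h3 := H.tri (h * u) (h * y) y
    have h4 := H.tri (h * x) x (h * y)
    have h5 := H.tri x y (h * y)
    rw [H.symm (h * x) x] at h2 h4
    rw [H.symm (h * y) y] at h3
    rw [H.inv] at h2 h3 h4
    unfold gp at hu ⊢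
    linarith
  have h2 := H.four x y u (h * u)
  have h3 := H.tri x (h * x) (h * u)
  have h4 := H.tri y (h * y) (h * u)
  have h5 := H.nonneg x (h * x)
  rw [H.inv] at h3 h4
  unfold gp at hu h1
  rw [H.symm u x, H.symm u y] at hu
  rw [H.symm (h * u) x, H.symm (h * u) y] at h1
  rcases le_max_iff.1 (sub_le_iff_le_add.2 h2) with h7 | h7 <;> linarith

theorem exists_finite_displacement {φ : G} {τ : ℝ} (hτ : 0 < τ)
    (hlim : Filter.Tendsto (fun n : ℕ => D 1 (φ ^ n) / n) Filter.atTop (nhds τ))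
    (hwpd : ∀ K : ℝ, 0 < K → ∃ N : ℕ,
      {h | D 1 h < K ∧ D (φ ^ N) (h * φ ^ N) < K}.Finite) {κ : ℝ} (hκ : 0 ≤ κ) :
    ∃ N : ℕ, ∀ L ≥ N, {h | D 1 h ≤ κ ∧ D (φ ^ L) (h * φ ^ L) ≤ κ}.Finite := by
  obtain ⟨C, hC⟩ := H.exists_gp_pow_le hτ hlim
  have hC0 : 0 ≤ C := (H.gp_nonneg _ _ _).trans (hC 0 0)
  have hd := H.d_nonneg
  obtain ⟨N, hN⟩ := hwpd (2 * C + 6 * κ + 2 * d + 1) (by linarith)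
  refine ⟨N, fun L hL => hN.subset ?_⟩
  rintro h ⟨h1, h2⟩
  have h3 := hC N (L - N)
  rw [Nat.add_sub_cancel' hL] at h3
  have h4 := H.displacement_le h3 (by rwa [mul_one]) h2
  exact ⟨by linarith, by linarith⟩

end InvHyp

/-! ### Superlinear growth -/

theorem not_isOfFinOrder_of_tendsto {D : G → G → ℝ} {d : ℝ} (H : InvHyp D d) {φ : G} {τ : ℝ}
    (hτ : 0 < τ)
    (hlim : Filter.Tendsto (fun n : ℕ => D 1 (φ ^ n) / n) Filter.atTop (nhds τ)) :
    ¬ IsOfFinOrder φ := by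
  intro hfin
  obtain ⟨n, hn, hφ⟩ := isOfFinOrder_iff_pow_eq_one.1 hfin
  have h2 := hlim.comp (Filter.tendsto_id.const_mul_atTop' hn)
  have h3 : ((fun n : ℕ => D 1 (φ ^ n) / n) ∘ fun k : ℕ => n * id k) = fun _ => 0 := by
    funext k
    simp [pow_mul, hφ, H.self]
  rw [h3] at h2
  exact hτ.ne (tendsto_nhds_unique tendsto_const_nhds h2)

theorem WordNorm.exists_mul_le_growth {len : G → ℕ} (W : WordNorm len)
    (hNVC : NonVirtuallyCyclic G) {φ : G} (hφ : ¬ IsOfFinOrder φ) (A B : ℕ) :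
    ∃ a, A * (a + B) ≤ W.growth a := by
  classical
  have hinf : Infinite (G ⧸ Subgroup.zpowers φ) := by
    by_contra hfin
    rw [not_infinite_iff_finite] at hfin
    exact hNVC ⟨Subgroup.zpowers φ, Subgroup.finiteIndex_of_finite_quotient, inferInstance⟩
  obtain ⟨T, hT⟩ := Infinite.exists_subset_card_eq (G ⧸ Subgroup.zpowers φ) (A * (len φ + 1))
  set R := T.sup fun q => len q.out
  have hpow : ∀ i, len (φ ^ i) ≤ i * len φ := by
    intro i
    induction i with
    | zero => simp [W.one]
    | succ i ih =>
      have := W.mul_le (φ ^ i) φ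
      rw [pow_succ, add_mul, one_mul]
      omega
  refine ⟨R + (R + B) * len φ, ?_⟩
  have hcard : (T ×ˢ Finset.range (R + B + 1)).card ≤ W.growth (R + (R + B) * len φ) := by
    refine Finset.card_le_card_of_injOn (fun p => p.1.out * φ ^ p.2) ?_ ?_
    · rintro ⟨q, i⟩ hp
      rw [Finset.mem_coe, Finset.mem_product, Finset.mem_range] at hp
      have h1 : len q.out ≤ R := Finset.le_sup (f := fun q => len q.out) hp.1
      have h2 := W.mul_le q.out (φ ^ i)
      have h3 := hpow i
      have h4 : i * len φ ≤ (R + B) * len φ := Nat.mul_le_mul_right _ (by have := hp.2; omega)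
      rw [Finset.mem_coe, W.mem_fball]
      dsimp only
      omega
    · rintro ⟨q, i⟩ - ⟨q', i'⟩ - he
      dsimp only at he
      have hq : q = q' := by
        rw [← q.out_eq', ← q'.out_eq']
        have h1 : ∀ (q : G ⧸ Subgroup.zpowers φ) (i : ℕ),
            (QuotientGroup.mk (q.out * φ ^ i) : G ⧸ Subgroup.zpowers φ) =
              QuotientGroup.mk q.out := fun q i =>
          QuotientGroup.mk_mul_of_mem _ (Subgroup.npow_mem_zpowers φ i)
        exact (h1 q i).symm.trans ((congrArg _ he).trans (h1 q' i'))
      subst hq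
      rw [mul_right_inj] at he
      rw [injective_pow_iff_not_isOfFinOrder.2 hφ he]
  rw [Finset.card_product, hT, Finset.card_range] at hcard
  refine le_trans ?_ hcard
  rw [mul_assoc]
  refine Nat.mul_le_mul_left A ?_
  nlinarith

/-! ### Geometry of geodesic segments in hyperbolic spaces -/

namespace GeodesicSegment

theorem initial_mem_seg (γ : GeodesicSegment X) : γ.initial ∈ γ.seg :=
  ⟨0, ⟨le_rfl, γ.len_nonneg⟩, rfl⟩

theorem terminal_mem_seg (γ : GeodesicSegment X) : γ.terminal ∈ γ.seg :=
  ⟨γ.len, ⟨γ.len_nonneg, le_rfl⟩, rfl⟩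

theorem continuousOn (γ : GeodesicSegment X) : ContinuousOn γ.toFun (Set.Icc 0 γ.len) := by
  have h : LipschitzOnWith 1 γ.toFun (Set.Icc 0 γ.len) :=
    LipschitzOnWith.of_dist_le_mul fun s hs t ht => by
      rw [γ.isom s hs t ht, NNReal.coe_one, one_mul, Real.dist_eq]
  exact h.continuousOn

theorem isCompact_seg (γ : GeodesicSegment X) : IsCompact γ.seg :=
  isCompact_Icc.image_of_continuousOn γ.continuousOn

theorem isPreconnected_seg (γ : GeodesicSegment X) : IsPreconnected γ.seg :=
  isPreconnected_Icc.image _ γ.continuousOn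

theorem dist_add_dist (γ : GeodesicSegment X) {p : X} (hp : p ∈ γ.seg) :
    dist γ.initial p + dist p γ.terminal = dist γ.initial γ.terminal := by
  obtain ⟨t, ht, rfl⟩ := hp
  have h0 : (0 : ℝ) ∈ Set.Icc 0 γ.len := ⟨le_rfl, γ.len_nonneg⟩
  have h1 : γ.len ∈ Set.Icc 0 γ.len := ⟨γ.len_nonneg, le_rfl⟩
  unfold initial terminal
  rw [γ.isom 0 h0 t ht, γ.isom t ht _ h1, γ.isom 0 h0 _ h1, abs_of_nonpos (by linarith [ht.1]),
    abs_of_nonpos (by linarith [ht.2]), abs_of_nonpos (by linarith [γ.len_nonneg])]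
  ring

/-- The segment traversed backwards. -/
def reverse (γ : GeodesicSegment X) : GeodesicSegment X where
  len := γ.len
  len_nonneg := γ.len_nonneg
  toFun := fun t => γ.toFun (γ.len - t)
  isom := fun s hs t ht => by
    rw [γ.isom _ ⟨by linarith [hs.2], by linarith [hs.1]⟩ _
      ⟨by linarith [ht.2], by linarith [ht.1]⟩, abs_sub_comm]
    congr 1
    ring

theorem reverse_initial (γ : GeodesicSegment X) : γ.reverse.initial = γ.terminal := by
  simp [reverse, initial, terminal]

theorem reverse_terminal (γ : GeodesicSegment X) : γ.reverse.terminal = γ.initial := by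
  simp [reverse, initial, terminal]

theorem reverse_seg (γ : GeodesicSegment X) : γ.reverse.seg = γ.seg := by
  ext p
  constructor
  · rintro ⟨t, ht, rfl⟩
    replace ht : t ∈ Set.Icc 0 γ.len := ht
    exact ⟨γ.len - t, ⟨by linarith [ht.2], by linarith [ht.1]⟩, rfl⟩
  · rintro ⟨t, ht, rfl⟩
    refine ⟨γ.len - t, ⟨by linarith [ht.2], sub_le_self _ ht.1⟩, ?_⟩
    simp [reverse]

/-- The part of a segment up to parameter `t`. -/
def upTo (γ : GeodesicSegment X) {t : ℝ} (ht : t ∈ Set.Icc 0 γ.len) : GeodesicSegment X where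
  len := t
  len_nonneg := ht.1
  toFun := γ.toFun
  isom := fun s hs u hu => γ.isom s ⟨hs.1, hs.2.trans ht.2⟩ u ⟨hu.1, hu.2.trans ht.2⟩

theorem upTo_seg_subset (γ : GeodesicSegment X) {t : ℝ} (ht : t ∈ Set.Icc 0 γ.len) :
    (γ.upTo ht).seg ⊆ γ.seg :=
  Set.image_mono (Set.Icc_subset_Icc_right ht.2)

end GeodesicSegment

section Hyperbolic

theorem exists_dist_le_of_mem_cthickening_seg {δ : ℝ} (hδ : 0 < δ) {γ : GeodesicSegment X} {p : X}
    (hp : p ∈ Metric.cthickening δ γ.seg) : ∃ q ∈ γ.seg, dist p q ≤ δ := by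
  rw [γ.isCompact_seg.cthickening_eq_biUnion_closedBall hδ.le] at hp
  simpa using hp

variable {δ : ℝ} (hδ : 0 < δ) (hgeo : IsGeodesicSpace X) (hhyp : IsDeltaHyperbolic X δ)
include hδ hhyp

theorem slim_triangle {γ₁ γ₂ γ₃ : GeodesicSegment X} (h1 : γ₁.initial = γ₃.initial)
    (h2 : γ₁.terminal = γ₂.initial) (h3 : γ₂.terminal = γ₃.terminal) {p : X} (hp : p ∈ γ₃.seg) :
    (∃ q ∈ γ₁.seg, dist p q ≤ δ) ∨ ∃ q ∈ γ₂.seg, dist p q ≤ δ := by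
  have h4 := hhyp γ₁ γ₂ γ₃ h1 h2 h3 hp
  rw [Metric.cthickening_union] at h4
  exact h4.imp (exists_dist_le_of_mem_cthickening_seg hδ)
    (exists_dist_le_of_mem_cthickening_seg hδ)

include hgeo

/-- Some point of a geodesic segment is nearly as close as the Gromov product. -/
theorem exists_mem_seg_dist_le (γ : GeodesicSegment X) (w : X) :
    ∃ p ∈ γ.seg, dist w p ≤ gromovProd w γ.initial γ.terminal + 2 * δ := by
  obtain ⟨α, hα₁, hα₂⟩ := hgeo γ.initial w
  obtain ⟨β, hβ₁, hβ₂⟩ := hgeo w γ.terminal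
  have hcover : γ.seg ⊆ Metric.cthickening δ α.seg ∪ Metric.cthickening δ β.seg := by
    rw [← Metric.cthickening_union]
    exact hhyp α β γ hα₁ (hα₂.trans hβ₁.symm) hβ₂
  obtain ⟨p, hp, hpα, hpβ⟩ := isPreconnected_closed_iff.1 γ.isPreconnected_seg _ _
    Metric.isClosed_cthickening Metric.isClosed_cthickening hcover
    ⟨γ.initial, γ.initial_mem_seg,
      Metric.self_subset_cthickening _ (hα₁ ▸ α.initial_mem_seg)⟩
    ⟨γ.terminal, γ.terminal_mem_seg,
      Metric.self_subset_cthickening _ (hβ₂ ▸ β.terminal_mem_seg)⟩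
  obtain ⟨q, hq, hpq⟩ := exists_dist_le_of_mem_cthickening_seg hδ hpα
  obtain ⟨r, hr, hpr⟩ := exists_dist_le_of_mem_cthickening_seg hδ hpβ
  refine ⟨p, hp, ?_⟩
  have h1 := α.dist_add_dist hq
  have h2 := β.dist_add_dist hr
  have h3 := γ.dist_add_dist hp
  rw [hα₁, hα₂] at h1
  rw [hβ₁, hβ₂] at h2
  have h4 := dist_triangle w q p
  have h5 := dist_triangle w r p
  have h6 := dist_triangle γ.initial q p
  have h7 := dist_triangle p r γ.terminal
  rw [dist_comm w q, dist_comm q p] at h4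
  rw [dist_comm r p] at h5
  rw [dist_comm q p] at h6
  unfold gromovProd
  rw [dist_comm γ.initial w] at *
  linarith

theorem four_point (x y z w : X) :
    dist x y + dist z w ≤ max (dist x z + dist y w) (dist x w + dist y z) + 2 * (3 * δ) := by
  obtain ⟨γ, hγ₁, hγ₂⟩ := hgeo x y
  obtain ⟨α, hα₁, hα₂⟩ := hgeo x z
  obtain ⟨β, hβ₁, hβ₂⟩ := hgeo z y
  obtain ⟨p, hp, hwp⟩ := exists_mem_seg_dist_le hδ hgeo hhyp γ w
  rw [hγ₁, hγ₂] at hwp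
  unfold gromovProd at hwp
  rw [← sub_le_iff_le_add, le_max_iff]
  rcases slim_triangle hδ hhyp (hα₁.trans hγ₁.symm) (hα₂.trans hβ₁.symm) (hβ₂.trans hγ₂.symm) hp
    with ⟨q, hq, hpq⟩ | ⟨q, hq, hpq⟩
  · left
    have h1 := α.dist_add_dist hq
    rw [hα₁, hα₂] at h1
    have h2 := dist_triangle x q w
    have h3 := dist_triangle z q w
    have h4 := dist_triangle w p q
    rw [dist_comm z q] at h3
    rw [dist_comm q w] at *
    rw [dist_comm w y] at *
    linarith
  · right
    have h1 := β.dist_add_dist hq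
    rw [hβ₁, hβ₂] at h1
    have h2 := dist_triangle y q w
    have h3 := dist_triangle z q w
    have h4 := dist_triangle w p q
    rw [dist_comm y q] at h2
    rw [dist_comm q w] at *
    rw [dist_comm w y] at *
    rw [dist_comm y z]
    linarith

theorem dist_initial_le_of_mem_proj {γ : GeodesicSegment X} {x p : X} (hp : p ∈ proj γ x) :
    dist γ.initial p + dist p x ≤ dist γ.initial x + 4 * δ := by
  obtain ⟨⟨t, ht, rfl⟩, hmin⟩ := hp
  obtain ⟨q, hq, hxq⟩ := exists_mem_seg_dist_le hδ hgeo hhyp (γ.upTo ht) x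
  have h1 := Metric.infDist_le_dist_of_mem (x := x) (γ.upTo_seg_subset ht hq)
  rw [← hmin] at h1
  have h2 := h1.trans hxq
  change _ ≤ gromovProd x γ.initial (γ.toFun t) + 2 * δ at h2
  unfold gromovProd at h2
  rw [dist_comm _ x]
  linarith

theorem dist_initial_le_gromovProd {γ : GeodesicSegment X} {x p : X} (hp : p ∈ proj γ x) :
    dist p γ.initial ≤ gromovProd γ.initial γ.terminal x + 2 * δ := by
  have h1 := dist_initial_le_of_mem_proj hδ hgeo hhyp hp
  have h2 := γ.dist_add_dist hp.1
  have h3 := dist_triangle γ.terminal p x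
  unfold gromovProd
  rw [dist_comm γ.terminal p] at h3
  rw [dist_comm p γ.initial, dist_comm γ.terminal γ.initial]
  linarith

theorem dist_terminal_le_gromovProd {γ : GeodesicSegment X} {x p : X} (hp : p ∈ proj γ x) :
    dist p γ.terminal ≤ gromovProd γ.terminal γ.initial x + 2 * δ := by
  have hp' : p ∈ proj γ.reverse x := by
    unfold proj at hp ⊢
    rwa [γ.reverse_seg]
  have h := dist_initial_le_gromovProd hδ hgeo hhyp hp'
  rwa [γ.reverse_initial, γ.reverse_terminal] at h

theorem gromovProd_le_of_mem_seg {η : GeodesicSegment X} {o x y : X} {r : ℝ}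
    (h1 : gromovProd o x η.initial ≤ r) (h2 : gromovProd o x η.terminal ≤ r) (hy : y ∈ η.seg) :
    gromovProd o x y ≤ 2 * r + 6 * δ := by
  have h3 := η.dist_add_dist hy
  have h4 := four_point hδ hgeo hhyp o y x η.initial
  have h5 := four_point hδ hgeo hhyp o y x η.terminal
  have h6 := dist_triangle η.initial o η.terminal
  have h7 := dist_triangle o y x
  have h8 := dist_triangle x o η.initial
  have h9 := dist_triangle x o η.terminal
  unfold gromovProd at *
  rw [dist_comm x o] at *
  rw [dist_comm η.initial o] at h6
  rw [dist_comm y x, dist_comm y η.initial] at h4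
  rw [dist_comm y x] at h5 h7
  rcases le_max_iff.1 (sub_le_iff_le_add.2 h4) with h | h <;>
    rcases le_max_iff.1 (sub_le_iff_le_add.2 h5) with h' | h' <;> linarith

theorem diam_projSet_terminal_le {γ η : GeodesicSegment X} {r : ℝ} (hr : 0 ≤ r)
    (h1 : gromovProd γ.terminal γ.initial η.initial ≤ r)
    (h2 : gromovProd γ.terminal γ.initial η.terminal ≤ r) :
    Metric.diam (projSet γ η.seg ∪ {γ.terminal}) ≤ 4 * r + 16 * δ := by
  have h : ∀ p ∈ projSet γ η.seg ∪ {γ.terminal}, dist p γ.terminal ≤ 2 * r + 8 * δ := by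
    rintro p (hp | rfl)
    · obtain ⟨y, hy, hp⟩ := Set.mem_iUnion₂.1 hp
      have h3 := gromovProd_le_of_mem_seg hδ hgeo hhyp h1 h2 hy
      have h4 := dist_terminal_le_gromovProd hδ hgeo hhyp hp
      linarith
    · rw [dist_self]
      linarith
  refine Metric.diam_le_of_forall_dist_le (by linarith) fun p hp q hq => ?_
  have h3 := dist_triangle_right p q γ.terminal
  linarith [h p hp, h q hq]

theorem alignedPair_of_gromovProd_le {γ η : GeodesicSegment X} {r K : ℝ} (hr : 0 ≤ r)
    (hK : 4 * r + 16 * δ < K)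
    (h1 : gromovProd γ.terminal γ.initial η.initial ≤ r)
    (h2 : gromovProd γ.terminal γ.initial η.terminal ≤ r)
    (h3 : gromovProd η.initial η.terminal γ.initial ≤ r)
    (h4 : gromovProd η.initial η.terminal γ.terminal ≤ r) :
    AlignedPair K γ η := by
  refine ⟨(diam_projSet_terminal_le hδ hgeo hhyp hr h1 h2).trans_lt hK, ?_⟩
  have h5 := diam_projSet_terminal_le (γ := η.reverse) (η := γ) hδ hgeo hhyp hr
    (by rwa [η.reverse_initial, η.reverse_terminal])
    (by rwa [η.reverse_initial, η.reverse_terminal])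
  unfold projSet proj at h5 ⊢
  rw [η.reverse_seg, η.reverse_terminal] at h5
  exact h5.trans_lt hK

theorem alignedPair_point_left {η : GeodesicSegment X} {r K : ℝ} (hr : 0 ≤ r)
    (hK : 4 * r + 16 * δ < K) {x : X} (h : gromovProd η.initial η.terminal x ≤ r) :
    AlignedPair K (GeodesicSegment.point x) η :=
  alignedPair_of_gromovProd_le hδ hgeo hhyp hr hK
    (by simpa [GeodesicSegment.point, GeodesicSegment.initial, GeodesicSegment.terminal,
      gromovProd] using hr)
    (by simpa [GeodesicSegment.point, GeodesicSegment.initial, GeodesicSegment.terminal,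
      gromovProd] using hr) h h

theorem alignedPair_point_right {γ : GeodesicSegment X} {r K : ℝ} (hr : 0 ≤ r)
    (hK : 4 * r + 16 * δ < K) {x : X} (h : gromovProd γ.terminal γ.initial x ≤ r) :
    AlignedPair K γ (GeodesicSegment.point x) :=
  alignedPair_of_gromovProd_le hδ hgeo hhyp hr hK h h
    (by simpa [GeodesicSegment.point, GeodesicSegment.initial, GeodesicSegment.terminal,
      gromovProd] using hr)
    (by simpa [GeodesicSegment.point, GeodesicSegment.initial, GeodesicSegment.terminal,
      gromovProd] using hr)

end Hyperbolic

/-! ### The orbit pseudo-metric -/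

/-- The pseudo-metric on the group induced by the orbit map of `x0`. -/
noncomputable def orbitDist (ρ : G → X → X) (x0 : X) (g h : G) : ℝ := dist (ρ g x0) (ρ h x0)

omit [Group G] in
theorem gromovProd_eq_gp (ρ : G → X → X) (x0 : X) (o a b : G) :
    gromovProd (ρ o x0) (ρ a x0) (ρ b x0) = gp (orbitDist ρ x0) o a b := by
  unfold gromovProd gp orbitDist
  rw [dist_comm (ρ a x0) (ρ o x0)]

theorem eq_one_of_wordLength_eq_zero {S : Finset G} (hS : Subgroup.closure (S : Set G) = ⊤)
    {g : G} (hg : wordLength S g = 0) : g = 1 := by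
  obtain ⟨l, hl, -, rfl⟩ := exists_word hS g
  rw [List.length_eq_zero_iff.1 (hl.trans hg), List.prod_nil]

theorem WordNorm.exists_lipschitz {len : G → ℕ} (W : WordNorm len) {D : G → G → ℝ} {d : ℝ}
    (H : InvHyp D d) (hlen : ∀ g, len g = 0 → g = 1) :
    ∃ K, 0 < K ∧ ∀ g h, D g h ≤ K * len (g⁻¹ * h) := by
  have hsum : 0 ≤ ∑ s ∈ W.fball 1, D 1 s := Finset.sum_nonneg fun s _ => H.nonneg 1 s
  refine ⟨1 + ∑ s ∈ W.fball 1, D 1 s, by linarith, ?_⟩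
  have hgen : ∀ s, len s ≤ 1 → D 1 s ≤ 1 + ∑ s ∈ W.fball 1, D 1 s := fun s hs => by
    have := Finset.single_le_sum (f := fun s => D 1 s) (fun s _ => H.nonneg 1 s)
      (W.mem_fball.2 hs)
    linarith
  have hone : ∀ n g, len g = n → D 1 g ≤ (1 + ∑ s ∈ W.fball 1, D 1 s) * n := by
    intro n
    induction n with
    | zero =>
      intro g hg
      rw [hlen g hg, H.self]
      simp
    | succ n ih =>
      intro g hg
      obtain ⟨g', hg', hs⟩ := W.parent g n hg
      have h1 := ih g' hg'
      have h2 := hgen _ hs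
      have h3 := H.tri 1 g' g
      have h4 := H.inv g' 1 (g'⁻¹ * g)
      rw [mul_one, mul_inv_cancel_left] at h4
      push_cast
      linarith
  intro g h
  have h1 := hone _ (g⁻¹ * h) rfl
  rwa [← H.inv g, mul_one, mul_inv_cancel_left] at h1

section Action

variable {S : Finset G} {ρ : G → X → X} (hisom : ∀ g : G, Isometry (ρ g))
  (hmul : ∀ g h : G, ∀ x : X, ρ (g * h) x = ρ g (ρ h x))

include hisom hmul in
theorem invHyp_orbitDist {δ : ℝ} (hδ : 0 < δ) (hgeo : IsGeodesicSpace X)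
    (hhyp : IsDeltaHyperbolic X δ) (x0 : X) : InvHyp (orbitDist ρ x0) (3 * δ) where
  d_nonneg := by positivity
  self := fun x => dist_self _
  symm := fun x y => dist_comm _ _
  tri := fun x y z => dist_triangle _ _ _
  inv := fun k x y => by
    unfold orbitDist
    rw [hmul, hmul, (hisom k).dist_eq]
  four := fun x y z w => four_point hδ hgeo hhyp _ _ _ _

include hisom hmul in
theorem exists_markerSystem (hSgen : Subgroup.closure (S : Set G) = ⊤)
    (hNVC : NonVirtuallyCyclic G) {δ : ℝ} (hδ : 0 < δ) (hgeo : IsGeodesicSpace X)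
    (hhyp : IsDeltaHyperbolic X δ) (hone : ∀ x : X, ρ 1 x = x) {x0 : X} {φ : G}
    (hlox : IsLoxodromic ρ x0 φ) (hwpd : HasWPD ρ x0 φ) {E0 : ℝ} (hE0 : E0Spec S ρ x0 φ E0) :
    ∃ L1 : ℝ, 0 < L1 ∧ ∃ K : ℝ, ∃ S₁ : Finset G, ∀ L : ℕ, L1 < L →
      MarkerSystem (wordLength S) (orbitDist ρ x0) (3 * δ) E0 K (φ ^ L) S₁ := by
  classical
  have H := invHyp_orbitDist hisom hmul hδ hgeo hhyp x0
  have W := wordNorm_wordLength hSgen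
  obtain ⟨τ, hτ, hlim⟩ := hlox
  obtain ⟨hE0pos, hcorr, -⟩ := hE0
  have hx0 : ∀ g, dist x0 (ρ g x0) = orbitDist ρ x0 1 g := fun g => by
    unfold orbitDist
    rw [hone]
  simp only [hx0] at hlim
  obtain ⟨K, hK, hlip⟩ := W.exists_lipschitz H fun g => eq_one_of_wordLength_eq_zero hSgen
  obtain ⟨N, hN⟩ := H.exists_finite_displacement hτ hlim
    (fun K hK => by
      obtain ⟨N, M, hfin, -⟩ := hwpd K hK
      refine ⟨N, hfin.subset ?_⟩
      rintro h ⟨h1, h2⟩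
      exact ⟨by rwa [hx0], by rwa [← hmul]⟩)
    (κ := 1 + 4 * (E0 + 3 * (3 * δ)) + 4 * (3 * δ)) (by positivity)
  obtain ⟨N', hN'⟩ := Filter.eventually_atTop.1
    (hlim.eventually (lt_mem_nhds (show τ / 2 < τ by linarith)))
  obtain ⟨N'', hN''⟩ := exists_nat_gt (20 * (E0 + 3 * (3 * δ)) / (τ / 2))
  have hgp : ∀ a b, gromovProd x0 (ρ a x0) (ρ b x0) = gp (orbitDist ρ x0) 1 a b := fun a b => by
    rw [← gromovProd_eq_gp, hone]
  refine ⟨N + N' + N'' + 1, by positivity, K, insert 1 S, fun L hL => ?_⟩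
  have hL' : N + N' + N'' + 1 < L := by exact_mod_cast hL
  have hLpos : (0 : ℝ) < L := by exact_mod_cast (by omega : 0 < L)
  refine
    { word := W
      hyp := H
      d_pos := by positivity
      c_pos := hE0pos
      K_pos := hK
      lip := hlip
      long := ?_
      fin := hN L (by omega)
      len_corr := fun s hs => wordLength_le_one ((Finset.mem_insert.1 hs).symm)
      corr_left := fun g => ?_
      corr_right := fun g => ?_
      superlinear := W.exists_mul_le_growth hNVC (not_isOfFinOrder_of_tendsto H hτ hlim) }
  · have h1 := hN' L (by omega)
    rw [lt_div_iff₀ hLpos] at h1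
    rw [div_lt_iff₀ (by linarith)] at hN''
    have h2 : (N'' : ℝ) ≤ L := by exact_mod_cast (by omega : N'' ≤ L)
    have h3 := mul_le_mul_of_nonneg_right h2 (by linarith : 0 ≤ τ / 2)
    linarith
  · obtain ⟨s, -, hs, -, h1, -⟩ := hcorr g
    refine ⟨s, Finset.mem_insert.2 hs.symm, ?_⟩
    have h2 := h1 L (by omega)
    rwa [zpow_natCast, hgp] at h2
  · obtain ⟨-, t, -, ht, -, h1⟩ := hcorr g
    refine ⟨t, Finset.mem_insert.2 ht.symm, ?_⟩
    have h2 := h1 (-L) (by omega)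
    rwa [zpow_neg, zpow_natCast, hgp] at h2

/-! ### From chains of markers to aligned sequences -/

omit [Group G] in
theorem translate_initial {Υ : GeodesicSegment X} {x0 : X} (h0 : Υ.initial = x0) (h : G) :
    (Υ.translate (ρ h) (hisom h)).initial = ρ h x0 := by
  rw [← h0]
  rfl

include hmul in
theorem translate_terminal {Υ : GeodesicSegment X} {x0 : X} {f : G} (h1 : Υ.terminal = ρ f x0)
    (h : G) : (Υ.translate (ρ h) (hisom h)).terminal = ρ (h * f) x0 := by
  rw [hmul, ← h1]
  rfl

theorem MarkerSystem.consecutive {len : G → ℕ} {D : G → G → ℝ} {d c K : ℝ} {f : G}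
    {S₁ : Finset G} (M : MarkerSystem len D d c K f S₁) {Q : ℝ}
    (hQ : 2 * D 1 f + 2 * K + 20 * (c + 3 * d) + 2 ≤ Q) {y h h' : G}
    (hm : Marker D f (c + 2 * d) 1 y h) (hm' : Marker D f (c + 2 * d) 1 y h')
    (hgap : D 1 h + Q ≤ D 1 h') :
    gp D (h * f) h h' ≤ c + 3 * d ∧ gp D (h * f) h (h' * f) ≤ c + 3 * d ∧
      gp D h' (h' * f) h ≤ c + 3 * d ∧ gp D h' (h' * f) (h * f) ≤ c + 3 * d := by
  have H := M.hyp
  have hf := M.long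
  have hc := M.c_pos
  have hd := M.d_pos
  have hK := M.K_pos
  have h1 := hm'.sub_le_gp H (by linarith)
  have h2 := H.gp_sub_le 1 h' (h' * f) y
  rw [Marker.dist_eq H] at h2
  have h3 := H.gp_le_dist 1 h y
  have h4 := H.gp_le_dist 1 (h * f) y
  have h5 := Marker.dist_right_le H 1 h f
  have h6 := hm.right_of_lt H (w := h') (by linarith)
  have h7 := hm.right_of_lt H (w := h' * f) (by linarith)
  have h8 := hm'.left_of_lt H (by linarith) (v := h) (by linarith)
  have h9 := hm'.left_of_lt H (by linarith) (v := h * f) (by linarith)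
  rw [H.gp_symm] at h8 h9
  exact ⟨by linarith, by linarith, by linarith, by linarith⟩

include hmul in
theorem mem_Wset_of_markerChain {δ : ℝ} (hδ : 0 < δ) (hgeo : IsGeodesicSpace X)
    (hhyp : IsDeltaHyperbolic X δ) (hone : ∀ x : X, ρ 1 x = x) {x0 : X} {f : G} {E0 K : ℝ}
    {S₁ : Finset G}
    (M : MarkerSystem (wordLength S) (orbitDist ρ x0) (3 * δ) E0 K f S₁) {Q : ℝ}
    (hQ : 2 * orbitDist ρ x0 1 f + 2 * K + 20 * (E0 + 3 * (3 * δ)) + 2 ≤ Q)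
    {Υ : GeodesicSegment X} (h0 : Υ.initial = x0) (h1 : Υ.terminal = ρ f x0) {ε : ℝ} {n : ℕ}
    {g : G} (hpos : 0 < ⌈ε * (n : ℝ)⌉₊) (hg : wordLength S g ≤ n) {h : ℕ → G}
    (hc : MarkerChain (orbitDist ρ x0) f (E0 + 2 * (3 * δ)) Q ⌈ε * (n : ℝ)⌉₊ g h)
    (hinv : gp (orbitDist ρ x0) (h 0) g⁻¹ (h 0 * f) ≤ E0 + 3 * (3 * δ))
    (hsq : gp (orbitDist ρ x0) (h (⌈ε * (n : ℝ)⌉₊ - 1) * f) (h (⌈ε * (n : ℝ)⌉₊ - 1)) (g ^ 2) ≤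
      E0 + 3 * (3 * δ)) :
    g ∈ Wset S ρ hisom x0 δ E0 Υ ε n := by
  have H := M.hyp
  have hE := M.c_pos
  obtain ⟨m, hm⟩ : ∃ m, ⌈ε * (n : ℝ)⌉₊ = m + 1 := ⟨_, (Nat.succ_pred_eq_of_pos hpos).symm⟩
  rw [hm] at hc hsq
  rw [Nat.add_sub_cancel] at hsq
  have hr : 0 ≤ E0 + 3 * (3 * δ) := by positivity
  have hK : 4 * (E0 + 3 * (3 * δ)) + 16 * δ < 6 * E0 + 360 * δ := by linarith
  have hinit := translate_initial hisom h0
  have hterm := translate_terminal hisom hmul h1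
  have hleft : ∀ x k, gp (orbitDist ρ x0) k x (k * f) ≤ E0 + 3 * (3 * δ) →
      AlignedPair (6 * E0 + 360 * δ) (GeodesicSegment.point (ρ x x0))
        (Υ.translate (ρ k) (hisom k)) := fun x k hk =>
    alignedPair_point_left hδ hgeo hhyp hr hK
      (by rwa [hinit, hterm, gromovProd_eq_gp, H.gp_symm])
  have hright : ∀ x k, gp (orbitDist ρ x0) (k * f) k x ≤ E0 + 3 * (3 * δ) →
      AlignedPair (6 * E0 + 360 * δ) (Υ.translate (ρ k) (hisom k))
        (GeodesicSegment.point (ρ x x0)) := fun x k hk =>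
    alignedPair_point_right hδ hgeo hhyp hr hK (by rwa [hinit, hterm, gromovProd_eq_gp])
  refine ⟨Nat.cast_le (α := ℝ).2 hg, fun i => h (i - 1), ?_, hleft _ _ hinv, ?_⟩
  · rw [hm]
    unfold AlignedSeq transList
    change List.IsChain _ _
    simp only [Nat.add_sub_cancel]
    rw [List.append_assoc, List.singleton_append, List.isChain_cons, List.isChain_append,
      List.isChain_map]
    refine ⟨?_, ?_, List.isChain_singleton _, ?_⟩
    · rw [List.range_succ_eq_map]
      simp only [List.map_cons, List.cons_append, List.head?_cons, Option.mem_def,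
        Option.some.injEq, forall_eq']
      have h2 := hleft 1 (h 0) ((hc.marker 0 (by omega)).1.trans (by linarith))
      rwa [hone] at h2
    · rw [List.isChain_range]
      intro i hi
      obtain ⟨e1, e2, e3, e4⟩ := M.consecutive hQ (hc.marker i (by omega))
        (hc.marker (i + 1) (by omega)) (hc.gap i (by omega))
      exact alignedPair_of_gromovProd_le hδ hgeo hhyp hr hK
        (by rwa [hinit, hterm, hinit, gromovProd_eq_gp])
        (by rwa [hinit, hterm, hterm, gromovProd_eq_gp])
        (by rwa [hinit, hterm, hinit, gromovProd_eq_gp])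
        (by rwa [hinit, hterm, hterm, gromovProd_eq_gp])
    · rw [List.range_succ]
      simp only [List.map_append, List.map_cons, List.map_nil, List.getLast?_concat,
        List.head?_cons, Option.mem_def, Option.some.injEq, forall_eq']
      exact hright g (h m) ((hc.marker m (by omega)).2.trans (by linarith))
  · simp only [hm, Nat.add_sub_cancel]
    exact hright _ _ hsq

end Action

/-- Final step in the proof of Theorem 1.2: the complement of `W_{L,ε}(n)` in `B_S(n)`
has upper density at most `η` for suitable `ε`. -/
theorem W_generic {G : Type*} [Group G] {X : Type*} [MetricSpace X]
    (S : Finset G) (hSgen : Subgroup.closure (S : Set G) = ⊤)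
    (hNVC : NonVirtuallyCyclic G)
    (δ : ℝ) (hδ : 0 < δ) (hgeo : IsGeodesicSpace X) (hhyp : IsDeltaHyperbolic X δ)
    (ρ : G → X → X) (hisom : ∀ g : G, Isometry (ρ g))
    (hmul : ∀ g h : G, ∀ x : X, ρ (g * h) x = ρ g (ρ h x)) (hone : ∀ x : X, ρ 1 x = x)
    (x0 : X) (φ : G)
    (hlox : IsLoxodromic ρ x0 φ) (hwpd : HasWPD ρ x0 φ)
    (E0 : ℝ) (hE0 : E0Spec S ρ x0 φ E0) :
    ∃ L1 : ℝ, 0 < L1 ∧ ∀ L : ℕ, L1 < (L : ℝ) →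
      ∀ Υ : GeodesicSegment X, Υ.initial = x0 → Υ.terminal = ρ (φ ^ L) x0 →
      ∀ η : ℝ, 0 < η → ∃ ε : ℝ, 0 < ε ∧
        Filter.limsup (fun n : ℕ =>
            (((ball S (n:ℝ) \ Wset S ρ hisom x0 δ E0 Υ ε n).ncard : ℝ) /
              ((ball S (n:ℝ)).ncard : ℝ)))
          Filter.atTop ≤ η := by
  obtain ⟨L1, hL1, K, S₁, hM⟩ :=
    exists_markerSystem hisom hmul hSgen hNVC hδ hgeo hhyp hone hlox hwpd hE0
  refine ⟨L1, hL1, fun L hL Υ h0 h1 η hη => ?_⟩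
  have M := hM L hL
  obtain ⟨Q, hQ⟩ :=
    exists_nat_ge (2 * orbitDist ρ x0 1 (φ ^ L) + 2 * K + 20 * (E0 + 3 * (3 * δ)) + 2)
  obtain ⟨ε, hε, n₀, hn₀⟩ := M.exists_good_chain_density hQ hη
  refine ⟨ε, hε, Filter.limsup_le_of_le
    (Filter.isCoboundedUnder_le_of_le _ fun n => (by positivity)) ?_⟩
  filter_upwards [Filter.eventually_ge_atTop (max n₀ 1)] with n hn
  have hball : ball S (n : ℝ) = {g | wordLength S g ≤ n} := by
    ext g
    exact Nat.cast_le (α := ℝ)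
  have hcard : (ball S (n : ℝ)).ncard = M.word.growth n := by
    rw [hball]
    exact Set.ncard_eq_toFinset_card _ (M.word.finite n)
  have hpos : 0 < ⌈ε * (n : ℝ)⌉₊ := by
    have : (0 : ℝ) < n := by exact_mod_cast (le_max_right n₀ 1).trans hn
    exact Nat.ceil_pos.2 (by positivity)
  rw [hcard, div_le_iff₀ (by exact_mod_cast M.word.growth_pos n)]
  refine le_trans ?_ (hn₀ n ((le_max_left _ _).trans hn))
  rw [Nat.cast_le]
  refine Set.ncard_le_ncard ?_ ((M.word.finite n).subset fun g hg => hg.1)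
  rintro g ⟨hg, hgW⟩
  rw [hball] at hg
  refine ⟨hg, fun ⟨h, hc, hinv, hsq⟩ => hgW ?_⟩
  exact mem_Wset_of_markerChain hisom hmul hδ hgeo hhyp hone M hQ h0 h1 hpos hg hc hinv hsq

end AcylCount
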